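/- arXiv:1312.7770 — 2 statements merged into one kernel-verified Lean document; each statement's English description precedes it below -/
import Mathlib

section
/- Let n ≥ 2. Let M = (Fin n → ℤ) ⋊ Equiv.Perm (Fin n) with full generating set S_M = {(±e_i, 1)} ∪ {(k(e_i − e_j), swap i j) : i ≠ j, k ∈ ℤ} and word length ℓ_M, and let W = (Fin n → ZMod 2) ⋊ Equiv.Perm (Fin n) with generating set R equal to the conjugation closure of {(e_i, 1)} ∪ {(0, swap i j)} and word length ℓ_W. Let π : M → W be the homomorphism reducing the translation part modulo 2 and fixing the permutation part, and let w = (e_1, 1)·(0, swap 1 2)⋯(0, swap (n−1) n) ∈ M. Then π restricts to a bijection from the interval [1,w] in M onto the interval [1,π(w)] in W that is an isomorphism of partially ordered sets. -/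
open Multiplicative

/-- The automorphism of `Multiplicative (Fin n → A)` permuting coordinates by `π`. -/
def permMulAut {n : ℕ} {A : Type*} [AddCommGroup A] (π : Equiv.Perm (Fin n)) :
    MulAut (Multiplicative (Fin n → A)) where
  toFun v := ofAdd fun i => toAdd v (π⁻¹ i)
  invFun v := ofAdd fun i => toAdd v (π i)
  left_inv v := by
    refine Multiplicative.toAdd.injective (funext fun i => ?_)
    simp
  right_inv v := by
    refine Multiplicative.toAdd.injective (funext fun i => ?_)
    simp
  map_mul' a b := rfl

/-- The coordinate-permutation action of `Equiv.Perm (Fin n)` on `Multiplicative (Fin n → A)`. -/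
def permAction (n : ℕ) (A : Type*) [AddCommGroup A] :
    Equiv.Perm (Fin n) →* MulAut (Multiplicative (Fin n → A)) where
  toFun := permMulAut
  map_one' := by
    refine MulEquiv.ext fun v => ?_
    refine Multiplicative.toAdd.injective (funext fun i => ?_)
    simp [permMulAut]
  map_mul' π σ := by
    refine MulEquiv.ext fun v => ?_
    refine Multiplicative.toAdd.injective (funext fun i => ?_)
    simp [permMulAut]

/-- The middle group `Mid(B_n) = (Fin n → ℤ) ⋊ Equiv.Perm (Fin n)`. -/
abbrev Mid (n : ℕ) := Multiplicative (Fin n → ℤ) ⋊[permAction n ℤ] Equiv.Perm (Fin n)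

/-- The Coxeter group `Cox(B_n) = (Fin n → ZMod 2) ⋊ Equiv.Perm (Fin n)`. -/
abbrev CoxB (n : ℕ) := Multiplicative (Fin n → ZMod 2) ⋊[permAction n (ZMod 2)] Equiv.Perm (Fin n)

/-- The full generating set of the middle group: translations `(±e_i, 1)` and reflections
`r_{ij}(k) = (k(e_i − e_j), swap i j)`. -/
def midGens (n : ℕ) : Set (Mid n) :=
  {x | (∃ i : Fin n, x = SemidirectProduct.inl (ofAdd (Pi.single i (1 : ℤ))) ∨
          x = SemidirectProduct.inl (ofAdd (-Pi.single i (1 : ℤ)))) ∨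
       (∃ i j : Fin n, ∃ k : ℤ, i ≠ j ∧
          x = ⟨ofAdd (k • (Pi.single i (1 : ℤ) - Pi.single j (1 : ℤ))), Equiv.swap i j⟩)}

/-- The generators `t_i = (e_i, 1)` and `r_{ij} = (0, swap i j)` of `Cox(B_n)`. -/
def coxBGens (n : ℕ) : Set (CoxB n) :=
  {x | (∃ i : Fin n, x = SemidirectProduct.inl (ofAdd (Pi.single i (1 : ZMod 2)))) ∨
       (∃ i j : Fin n, i ≠ j ∧ x = SemidirectProduct.inr (Equiv.swap i j))}

/-- The reflections of `Cox(B_n)`: the conjugation closure of the generators. -/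
def coxBRefl (n : ℕ) : Set (CoxB n) :=
  {x | ∃ s ∈ coxBGens n, ∃ g : CoxB n, x = g * s * g⁻¹}

/-- Word length with respect to a generating set `S`. -/
noncomputable def wordLength {G : Type*} [Group G] (S : Set G) (g : G) : ℕ :=
  sInf {k | ∃ l : List G, l.length = k ∧ (∀ x ∈ l, x ∈ S) ∧ l.prod = g}

/-- Reduction of integer vectors modulo 2, as a homomorphism of multiplicative groups. -/
def redMod2 (n : ℕ) : Multiplicative (Fin n → ℤ) →* Multiplicative (Fin n → ZMod 2) :=
  AddMonoidHom.toMultiplicative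
    { toFun := fun v i => ((v i : ℤ) : ZMod 2)
      map_zero' := by funext i; simp
      map_add' := by intro a b; funext i; simp [Pi.add_apply] }

/-- The projection `Mid(B_n) →* Cox(B_n)` reducing the translation part modulo 2 and fixing
the permutation part. -/
def midToCoxB (n : ℕ) : Mid n →* CoxB n :=
  SemidirectProduct.map (redMod2 n) (MonoidHom.id _) (fun _ => rfl)

/-- The special element `w = t_1 r_{12} r_{23} ⋯ r_{(n−1)n}` of the middle group. -/
def midSpecialElt (m : ℕ) : Mid (m + 2) :=
  SemidirectProduct.inl (φ := permAction (m + 2) ℤ)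
      (ofAdd (Pi.single (0 : Fin (m + 2)) (1 : ℤ))) *
    ((List.finRange (m + 1)).map
      (fun i => (SemidirectProduct.inr (Equiv.swap i.castSucc i.succ) : Mid (m + 2)))).prod

section WordLength

variable {G : Type*} [Group G] {S : Set G}

theorem wordLength_le_length {l : List G} (hl : ∀ x ∈ l, x ∈ S) :
    wordLength S l.prod ≤ l.length :=
  Nat.sInf_le ⟨l, rfl, hl, rfl⟩

theorem exists_word_of_closure_eq_top (hinv : ∀ x ∈ S, x⁻¹ ∈ S)
    (hS : Subgroup.closure S = ⊤) (g : G) :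
    ∃ l : List G, l.length = wordLength S g ∧ (∀ x ∈ l, x ∈ S) ∧ l.prod = g := by
  have hne : {k | ∃ l : List G, l.length = k ∧ (∀ x ∈ l, x ∈ S) ∧ l.prod = g}.Nonempty := by
    have hg : g ∈ (Subgroup.closure S).toSubmonoid := hS ▸ Subgroup.mem_top g
    rw [Subgroup.closure_toSubmonoid] at hg
    obtain ⟨l, hl, hprod⟩ := Submonoid.exists_list_of_mem_closure hg
    refine ⟨l.length, l, rfl, fun x hx => ?_, hprod⟩
    rcases hl x hx with h | h
    · exact h
    · simpa using hinv _ h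
  exact Nat.sInf_mem hne

theorem wordLength_mul_le (hw : ∀ g : G, ∃ l : List G, l.length = wordLength S g ∧
    (∀ x ∈ l, x ∈ S) ∧ l.prod = g) (g h : G) :
    wordLength S (g * h) ≤ wordLength S g + wordLength S h := by
  obtain ⟨l, hl, hlS, rfl⟩ := hw g
  obtain ⟨k, hk, hkS, rfl⟩ := hw h
  rw [← hl, ← hk, ← List.prod_append, ← List.length_append]
  refine wordLength_le_length fun x hx => ?_
  rcases List.mem_append.1 hx with h | h
  exacts [hlS x h, hkS x h]

end WordLength

theorem not_sameCycle_swap_mul {α : Type*} [DecidableEq α] [Finite α] {σ : Equiv.Perm α} {i j : α}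
    (hij : i ≠ j) (h : σ.SameCycle i j) : ¬ (Equiv.swap i j * σ).SameCycle i j := by
  intro h'
  obtain ⟨k, hk⟩ := h.exists_nat_pow_eq
  obtain ⟨k', hk'⟩ := h'.exists_nat_pow_eq
  have hex : ∃ m, 0 < m ∧ ((σ ^ m) i = i ∨ (σ ^ m) i = j) :=
    ⟨k, Nat.pos_of_ne_zero (by rintro rfl; exact hij (by simpa using hk)), Or.inr hk⟩
  classical
  obtain ⟨hm0, hm⟩ := Nat.find_spec hex
  have hmin := fun l => Nat.find_min hex (m := l)
  set m := Nat.find hex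
  have hagree : ∀ l < m, ((Equiv.swap i j * σ) ^ l) i = (σ ^ l) i := by
    intro l
    induction l with
    | zero => simp
    | succ l ih =>
      intro hl
      have := hmin _ hl
      push Not at this
      obtain ⟨h1, h2⟩ := this (Nat.succ_pos l)
      rw [pow_succ' (Equiv.swap i j * σ), Equiv.Perm.mul_apply, ih (by omega), Equiv.Perm.mul_apply,
        ← Equiv.Perm.mul_apply σ, ← pow_succ', Equiv.swap_apply_of_ne_of_ne h1 h2]
  have hmod : ∀ (τ : Equiv.Perm α) (q : ℕ), (τ ^ m) i = i → (τ ^ q) i = (τ ^ (q % m)) i := by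
    intro τ q hτ
    conv_lhs => rw [← Nat.mod_add_div q m, pow_add, Equiv.Perm.mul_apply, pow_mul]
    rw [Equiv.Perm.pow_apply_eq_self_of_apply_eq_self hτ]
  have hcontra : ∀ q, (σ ^ (q % m)) i ≠ j := by
    intro q hq
    rcases Nat.eq_zero_or_pos (q % m) with h0 | h0
    · rw [h0] at hq
      exact hij (by simpa using hq)
    · exact hmin _ (Nat.mod_lt _ hm0) ⟨h0, Or.inr hq⟩
  rcases hm with hm | hm
  · exact hcontra k (by rw [← hmod σ k hm, hk])
  · refine hcontra k' ?_
    rw [← hagree _ (Nat.mod_lt _ hm0), ← hmod _ k' ?_, hk']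
    obtain ⟨p, hp⟩ : ∃ p, m = p + 1 := ⟨m - 1, by omega⟩
    rw [hp, pow_succ', Equiv.Perm.mul_apply, hagree p (by omega), Equiv.Perm.mul_apply,
      ← Equiv.Perm.mul_apply σ, ← pow_succ', ← hp, hm, Equiv.swap_apply_right]

section Mid

variable {n : ℕ}

/-- The translation part of an element of the middle group. -/
def midVec (g : Mid n) : Fin n → ℤ := toAdd g.left

theorem mid_ext {g h : Mid n} (hv : ∀ l, midVec g l = midVec h l) (hp : g.right = h.right) :
    g = h :=
  SemidirectProduct.ext (Multiplicative.toAdd.injective (funext hv)) hp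

theorem midVec_mul (g h : Mid n) (l : Fin n) :
    midVec (g * h) l = midVec g l + midVec h (g.right⁻¹ l) := rfl

@[simp] theorem midVec_one (l : Fin n) : midVec (1 : Mid n) l = 0 := rfl

theorem midVec_inv (g : Mid n) (l : Fin n) : midVec g⁻¹ l = -midVec g (g.right l) := by
  have := midVec_mul g g⁻¹ (g.right l)
  simp at this
  linarith

/-- The generator `(e_i, 1)`, raised to the power `c`. -/
def midTrans (i : Fin n) (c : ℤ) : Mid n := SemidirectProduct.inl (ofAdd (Pi.single i c))

/-- The generator `(k(e_i − e_j), swap i j)`. -/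
def midRefl (i j : Fin n) (k : ℤ) : Mid n :=
  ⟨ofAdd (k • (Pi.single i (1 : ℤ) - Pi.single j (1 : ℤ))), Equiv.swap i j⟩

@[simp] theorem midTrans_right (i : Fin n) (c : ℤ) : (midTrans i c).right = 1 := rfl

@[simp] theorem midRefl_right (i j : Fin n) (k : ℤ) : (midRefl i j k).right = Equiv.swap i j := rfl

theorem midVec_midTrans (i : Fin n) (c : ℤ) (l : Fin n) :
    midVec (midTrans i c) l = if l = i then c else 0 := by
  simp [midVec, midTrans, Pi.single_apply]

theorem midVec_midRefl (i j : Fin n) (k : ℤ) (l : Fin n) :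
    midVec (midRefl i j k) l = k * ((if l = i then 1 else 0) - (if l = j then 1 else 0)) := by
  simp [midVec, midRefl, Pi.single_apply]

theorem mem_midGens_iff {x : Mid n} :
    x ∈ midGens n ↔ (∃ i, x = midTrans i 1 ∨ x = midTrans i (-1)) ∨
      ∃ i j k, i ≠ j ∧ x = midRefl i j k := by
  simp only [midGens, Set.mem_ofPred_eq, midTrans, midRefl, Pi.single_neg]

theorem midTrans_inv (i : Fin n) (c : ℤ) : (midTrans i c)⁻¹ = midTrans i (-c) := by
  refine mid_ext (fun l => ?_) (by simp)
  simp only [midVec_inv, midVec_midTrans, midTrans_right, Equiv.Perm.one_apply]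
  split_ifs <;> simp

theorem midRefl_inv {i j : Fin n} (k : ℤ) : (midRefl i j k)⁻¹ = midRefl i j k := by
  refine mid_ext (fun l => ?_) (by simp)
  simp only [midVec_inv, midVec_midRefl, midRefl_right]
  by_cases h1 : l = i
  · subst h1
    by_cases h2 : j = l
    · subst h2; simp
    · simp [h2, Ne.symm h2]
  · by_cases h2 : l = j
    · subst h2; simp [h1, Ne.symm h1]
    · simp [h1, h2, Equiv.swap_apply_of_ne_of_ne]

theorem midRefl_comm (i j : Fin n) (k : ℤ) : midRefl i j k = midRefl j i (-k) := by
  refine mid_ext (fun l => ?_) (by simp [Equiv.swap_comm])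
  simp only [midVec_midRefl]
  ring

theorem inv_mem_midGens {x : Mid n} (hx : x ∈ midGens n) : x⁻¹ ∈ midGens n := by
  rw [mem_midGens_iff] at hx ⊢
  rcases hx with ⟨i, rfl | rfl⟩ | ⟨i, j, k, hij, rfl⟩
  · exact Or.inl ⟨i, Or.inr (midTrans_inv i 1)⟩
  · exact Or.inl ⟨i, Or.inl (by simp [midTrans_inv])⟩
  · exact Or.inr ⟨i, j, k, hij, midRefl_inv k⟩

theorem midTrans_add (i : Fin n) (c d : ℤ) :
    midTrans i (c + d) = midTrans i c * midTrans i d := by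
  refine mid_ext (fun l => ?_) (by simp)
  simp only [midVec_mul, midVec_midTrans, midTrans_right, inv_one, Equiv.Perm.one_apply]
  split_ifs <;> simp

theorem closure_midGens : Subgroup.closure (midGens n) = ⊤ := by
  rw [eq_top_iff]
  rintro g -
  have hT : ∀ i c, midTrans i c ∈ Subgroup.closure (midGens n) := by
    intro i c
    have h1 : midTrans i 1 ∈ Subgroup.closure (midGens n) :=
      Subgroup.subset_closure (mem_midGens_iff.2 (Or.inl ⟨i, Or.inl rfl⟩))
    induction c with
    | zero =>
      convert Subgroup.one_mem _
      exact mid_ext (fun l => by simp [midVec_midTrans]) rfl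
    | succ c ih =>
      rw [midTrans_add]
      exact Subgroup.mul_mem _ ih h1
    | pred c ih =>
      rw [sub_eq_add_neg, midTrans_add, ← midTrans_inv i 1]
      exact Subgroup.mul_mem _ ih (Subgroup.inv_mem _ h1)
  have hL : ∀ v : Multiplicative (Fin n → ℤ),
      (SemidirectProduct.inl v : Mid n) ∈ Subgroup.closure (midGens n) := by
    intro v
    have hv : v = ∏ i, ofAdd (Pi.single i (toAdd v i)) := by
      refine Multiplicative.toAdd.injective ?_
      rw [toAdd_prod]
      simp only [toAdd_ofAdd]
      exact (Finset.univ_sum_single _).symm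
    suffices h : v ∈ (Subgroup.closure (midGens n)).comap SemidirectProduct.inl from h
    rw [hv]
    exact Subgroup.prod_mem _ fun i _ => hT i _
  have hR : ∀ σ : Equiv.Perm (Fin n),
      (SemidirectProduct.inr σ : Mid n) ∈ Subgroup.closure (midGens n) := by
    intro σ
    induction σ using Equiv.Perm.swap_induction_on with
    | one => simp
    | swap_mul f x y hxy ih =>
      rw [map_mul]
      refine Subgroup.mul_mem _ (Subgroup.subset_closure ?_) ih
      refine mem_midGens_iff.2 (Or.inr ⟨x, y, 0, hxy, mid_ext (fun l => ?_) rfl⟩)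
      simp only [midVec_midRefl, zero_mul]
      rfl
  rw [← SemidirectProduct.inl_left_mul_inr_right g]
  exact Subgroup.mul_mem _ (hL _) (hR _)

theorem exists_word_mid (g : Mid n) : ∃ l : List (Mid n),
    l.length = wordLength (midGens n) g ∧ (∀ x ∈ l, x ∈ midGens n) ∧ l.prod = g :=
  exists_word_of_closure_eq_top (fun _ => inv_mem_midGens) closure_midGens g

/-- The vectors fixed by `g` in the monomial representation of the middle group in which the
translation `e_i` scales the `i`-th coordinate by `z`. -/
def fixSpace (z : ℚˣ) (g : Mid n) : Submodule ℚ (Fin n → ℚ) where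
  carrier := {f | ∀ l, f (g.right l) = ((z ^ midVec g (g.right l) : ℚˣ) : ℚ) * f l}
  add_mem' {f h} hf hh l := by
    simp only [Pi.add_apply, hf l, hh l]
    ring
  zero_mem' l := by simp
  smul_mem' c f hf l := by
    simp only [Pi.smul_apply, hf l, smul_eq_mul]
    ring

theorem mem_fixSpace {z : ℚˣ} {g : Mid n} {f : Fin n → ℚ} :
    f ∈ fixSpace z g ↔ ∀ l, f (g.right l) = ((z ^ midVec g (g.right l) : ℚˣ) : ℚ) * f l := Iff.rfl

theorem one_mem_fixSpace (z : ℚˣ) (f : Fin n → ℚ) : f ∈ fixSpace z (1 : Mid n) := by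
  simp [mem_fixSpace]

theorem mul_mem_fixSpace {z : ℚˣ} {g h : Mid n} {f : Fin n → ℚ} (hg : f ∈ fixSpace z g)
    (hh : f ∈ fixSpace z h) : f ∈ fixSpace z (g * h) := by
  intro l
  have h1 := hg (h.right l)
  have h2 := hh l
  simp only [SemidirectProduct.mul_right, Equiv.Perm.mul_apply, midVec_mul,
    Equiv.Perm.inv_def, Equiv.symm_apply_apply, zpow_add, Units.val_mul]
  rw [h1, h2, mul_assoc]

/-- The vectors fixed by every member of a list. -/
def fixList (z : ℚˣ) (l : List (Mid n)) : Submodule ℚ (Fin n → ℚ) := ⨅ x ∈ l, fixSpace z x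

theorem mem_fixList {z : ℚˣ} {l : List (Mid n)} {f : Fin n → ℚ} :
    f ∈ fixList z l ↔ ∀ x ∈ l, f ∈ fixSpace z x := by
  simp [fixList, Submodule.mem_iInf]

theorem fixList_le_fixSpace_prod (z : ℚˣ) (l : List (Mid n)) :
    fixList z l ≤ fixSpace z l.prod := by
  intro f hf
  rw [mem_fixList] at hf
  induction l with
  | nil => exact one_mem_fixSpace z f
  | cons x l ih =>
    rw [List.prod_cons]
    exact mul_mem_fixSpace (hf x (by simp)) (ih fun y hy => hf y (by simp [hy]))

theorem le_finrank_fixList_add_length (z : ℚˣ) (l : List (Mid n))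
    (hl : ∀ x ∈ l, ∃ φ : (Fin n → ℚ) →ₗ[ℚ] ℚ, ∀ f, φ f = 0 → f ∈ fixSpace z x) :
    n ≤ Module.finrank ℚ (fixList z l) + l.length := by
  choose! φ hφ using hl
  let A : (Fin n → ℚ) →ₗ[ℚ] (Fin l.length → ℚ) := LinearMap.pi fun k => φ (l.get k)
  have hA := A.finrank_range_add_finrank_ker
  have h1 : Module.finrank ℚ (LinearMap.range A) ≤ l.length := by
    simpa using (LinearMap.range A).finrank_le
  have h2 : LinearMap.ker A ≤ fixList z l := by
    intro f hf
    rw [mem_fixList]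
    intro x hx
    obtain ⟨k, rfl⟩ := List.get_of_mem hx
    exact hφ _ hx f (congrFun (LinearMap.mem_ker.1 hf) k)
  have h3 := Submodule.finrank_mono h2
  simp only [Module.finrank_fintype_fun_eq_card, Fintype.card_fin] at hA
  omega

theorem mem_fixSpace_midTrans {z : ℚˣ} {i : Fin n} {c : ℤ} {f : Fin n → ℚ} (hf : f i = 0) :
    f ∈ fixSpace z (midTrans i c) := by
  intro l
  simp only [midTrans_right, Equiv.Perm.one_apply, midVec_midTrans]
  split_ifs with h
  · simp [h, hf]
  · simp

theorem mem_fixSpace_midRefl {z : ℚˣ} {i j : Fin n} (hij : i ≠ j) {k : ℤ} {f : Fin n → ℚ} :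
    f ∈ fixSpace z (midRefl i j k) ↔ f i = ((z ^ k : ℚˣ) : ℚ) * f j := by
  constructor
  · intro hf
    have := hf j
    simpa [midVec_midRefl, hij] using this
  · intro hf l
    simp only [midRefl_right, midVec_midRefl]
    by_cases h1 : l = i
    · subst h1
      simp [hij.symm, hf, ← mul_assoc, inv_mul_cancel₀ (zpow_ne_zero k z.ne_zero)]
    · by_cases h2 : l = j
      · subst h2
        simp [hij, hf]
      · simp [Equiv.swap_apply_of_ne_of_ne h1 h2, h1, h2]

theorem exists_functional_of_mem_midGens (z : ℚˣ) {x : Mid n} (hx : x ∈ midGens n) :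
    ∃ φ : (Fin n → ℚ) →ₗ[ℚ] ℚ, ∀ f, φ f = 0 → f ∈ fixSpace z x := by
  rw [mem_midGens_iff] at hx
  rcases hx with ⟨i, rfl | rfl⟩ | ⟨i, j, k, hij, rfl⟩
  · exact ⟨LinearMap.proj i, fun f hf => mem_fixSpace_midTrans hf⟩
  · exact ⟨LinearMap.proj i, fun f hf => mem_fixSpace_midTrans hf⟩
  · refine ⟨LinearMap.proj i - ((z ^ k : ℚˣ) : ℚ) • LinearMap.proj j, fun f hf => ?_⟩
    rw [mem_fixSpace_midRefl hij]
    simpa [sub_eq_zero] using hf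

/-- In a word of generators that is as short as the fixed space of its product allows, every letter
fixes the fixed space of the product. -/
theorem fixSpace_prod_le_of_tight (z : ℚˣ) {l : List (Mid n)} (hl : ∀ x ∈ l, x ∈ midGens n)
    (h : Module.finrank ℚ (fixSpace z l.prod) + l.length ≤ n) {x : Mid n} (hx : x ∈ l) :
    fixSpace z l.prod ≤ fixSpace z x := by
  have h1 := le_finrank_fixList_add_length z l
    fun x hx => exists_functional_of_mem_midGens z (hl x hx)
  have h2 := Submodule.eq_of_le_of_finrank_le (fixList_le_fixSpace_prod z l) (by omega)
  rw [← h2]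
  exact fun f hf => mem_fixList.1 hf x hx

/-- The codimension of the fixed space in the reflection representation of `Cox(B_n)`. -/
noncomputable def fixCodim (g : Mid n) : ℕ := n - Module.finrank ℚ (fixSpace (-1) g)

theorem finrank_fixSpace_le (z : ℚˣ) (g : Mid n) : Module.finrank ℚ (fixSpace z g) ≤ n := by
  simpa using (fixSpace z g).finrank_le

theorem fixCodim_prod_le_length {l : List (Mid n)} (hl : ∀ x ∈ l, x ∈ midGens n) :
    fixCodim l.prod ≤ l.length := by
  have h1 := le_finrank_fixList_add_length (-1) l
    fun x hx => exists_functional_of_mem_midGens _ (hl x hx)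
  have h2 := Submodule.finrank_mono (fixList_le_fixSpace_prod (-1) l)
  unfold fixCodim
  omega

/-- The sum of the translation part over a set of coordinates. -/
def blockSum (S : Finset (Fin n)) (g : Mid n) : ℤ := ∑ l ∈ S, midVec g l

/-- The set of coordinates `S` is invariant under the permutation part of `g`. -/
def IsInvBlock (S : Finset (Fin n)) (g : Mid n) : Prop := ∀ l, g.right l ∈ S ↔ l ∈ S

theorem IsInvBlock.inv_apply {S : Finset (Fin n)} {g : Mid n} (h : IsInvBlock S g) (l : Fin n) :
    g.right⁻¹ l ∈ S ↔ l ∈ S := by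
  rw [← h (g.right⁻¹ l), Equiv.Perm.inv_def, Equiv.apply_symm_apply]

theorem isInvBlock_univ (g : Mid n) : IsInvBlock Finset.univ g := fun l => by simp

theorem blockSum_mul {S : Finset (Fin n)} {g : Mid n} (hS : IsInvBlock S g) (h : Mid n) :
    blockSum S (g * h) = blockSum S g + blockSum S h := by
  simp only [blockSum, midVec_mul, Finset.sum_add_distrib]
  congr 1
  refine Finset.sum_equiv g.right⁻¹ (fun l => (hS.inv_apply l).symm) fun l _ => rfl

theorem IsInvBlock.mul {S : Finset (Fin n)} {g h : Mid n} (hg : IsInvBlock S g)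
    (hh : IsInvBlock S h) : IsInvBlock S (g * h) := fun l => by
  rw [SemidirectProduct.mul_right, Equiv.Perm.mul_apply, hg, hh]

theorem isInvBlock_inv {S : Finset (Fin n)} {g : Mid n} (hg : IsInvBlock S g) :
    IsInvBlock S g⁻¹ := fun l => by
  rw [SemidirectProduct.inv_right, hg.inv_apply]

theorem IsInvBlock.union {S T : Finset (Fin n)} {g : Mid n} (hS : IsInvBlock S g)
    (hT : IsInvBlock T g) : IsInvBlock (S ∪ T) g := fun l => by
  simp [hS l, hT l]

theorem IsInvBlock.sdiff {S T : Finset (Fin n)} {g : Mid n} (hS : IsInvBlock S g)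
    (hT : IsInvBlock T g) : IsInvBlock (S \ T) g := fun l => by
  simp [hS l, hT l]

theorem blockSum_union {S T : Finset (Fin n)} (h : Disjoint S T) (g : Mid n) :
    blockSum (S ∪ T) g = blockSum S g + blockSum T g := Finset.sum_union h

theorem blockSum_sdiff {S T : Finset (Fin n)} (h : T ⊆ S) (g : Mid n) :
    blockSum (S \ T) g = blockSum S g - blockSum T g := by
  rw [eq_sub_iff_add_eq]
  exact Finset.sum_sdiff h

theorem blockSum_midTrans (S : Finset (Fin n)) (i : Fin n) (c : ℤ) :
    blockSum S (midTrans i c) = if i ∈ S then c else 0 := by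
  simp [blockSum, midVec_midTrans]

theorem blockSum_midRefl (S : Finset (Fin n)) (i j : Fin n) (k : ℤ) :
    blockSum S (midRefl i j k) = k * ((if i ∈ S then 1 else 0) - (if j ∈ S then 1 else 0)) := by
  simp [blockSum, midVec_midRefl, ← Finset.mul_sum]

theorem isInvBlock_midRefl {S : Finset (Fin n)} {i j : Fin n} {k : ℤ} (h : i ∈ S ↔ j ∈ S) :
    IsInvBlock S (midRefl i j k) := by
  intro l
  rw [midRefl_right, Equiv.swap_apply_def]
  split_ifs with h1 h2
  · rw [h1, h]
  · rw [h2, h]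
  · rfl

/-- Every invariant block has translation sum `0` or `1`. -/
def IsBalanced (g : Mid n) : Prop :=
  ∀ S, IsInvBlock S g → blockSum S g = 0 ∨ blockSum S g = 1

/-- The cycle of `g` through the coordinate `i`. -/
def cycleBlock (g : Mid n) (i : Fin n) : Finset (Fin n) :=
  Finset.univ.filter fun l => g.right.SameCycle i l

theorem mem_cycleBlock {g : Mid n} {i l : Fin n} :
    l ∈ cycleBlock g i ↔ g.right.SameCycle i l := by simp [cycleBlock]

theorem self_mem_cycleBlock (g : Mid n) (i : Fin n) : i ∈ cycleBlock g i :=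
  mem_cycleBlock.2 (Equiv.Perm.SameCycle.refl _ _)

theorem isInvBlock_cycleBlock (g : Mid n) (i : Fin n) : IsInvBlock (cycleBlock g i) g := fun l => by
  rw [mem_cycleBlock, mem_cycleBlock, Equiv.Perm.sameCycle_apply_right]

theorem IsInvBlock.zpow {S : Finset (Fin n)} {g : Mid n} (h : IsInvBlock S g) (k : ℤ) :
    IsInvBlock S (g ^ k) ∧ blockSum S (g ^ k) = k * blockSum S g := by
  induction k with
  | zero =>
    refine ⟨fun l => by simp, by simp [blockSum]⟩
  | succ k ih =>
    rw [zpow_add_one]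
    refine ⟨ih.1.mul h, ?_⟩
    rw [blockSum_mul ih.1, ih.2]
    ring
  | pred k ih =>
    have hi := isInvBlock_inv h
    have h2 := blockSum_mul hi g
    rw [inv_mul_cancel] at h2
    have h1 : blockSum S (1 : Mid n) = 0 := by simp [blockSum]
    rw [zpow_sub_one]
    refine ⟨ih.1.mul hi, ?_⟩
    rw [blockSum_mul ih.1, ih.2]
    linarith

theorem IsInvBlock.cycleBlock_subset {S : Finset (Fin n)} {g : Mid n} (h : IsInvBlock S g)
    {i : Fin n} (hi : i ∈ S) : cycleBlock g i ⊆ S := by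
  intro l hl
  obtain ⟨k, rfl⟩ := mem_cycleBlock.1 hl
  have : (g ^ k).right = g.right ^ k := map_zpow SemidirectProduct.rightHom g k
  rw [← this, (h.zpow k).1]
  exact hi

theorem right_zpow (g : Mid n) (k : ℤ) : (g ^ k).right = g.right ^ k :=
  map_zpow SemidirectProduct.rightHom g k

theorem midVec_zpow_eq_zero {g : Mid n} {i : Fin n} (h0 : blockSum (cycleBlock g i) g = 0) {k : ℤ}
    (hk : (g.right ^ k) i = i) : midVec (g ^ k) i = 0 := by
  have hfix : ∀ l ∈ cycleBlock g i, (g.right ^ k) l = l := by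
    intro l hl
    obtain ⟨q, rfl⟩ := mem_cycleBlock.1 hl
    rw [← Equiv.Perm.mul_apply, ← zpow_add, add_comm, zpow_add, Equiv.Perm.mul_apply, hk]
  have hstep : ∀ l ∈ cycleBlock g i, midVec (g ^ k) (g.right l) = midVec (g ^ k) l := by
    intro l hl
    have h1 := congrArg (fun h => midVec h (g.right l)) ((Commute.refl g).zpow_right k).eq
    simp only [midVec_mul, right_zpow] at h1
    have h2 : (g.right ^ k)⁻¹ (g.right l) = g.right l := by
      rw [Equiv.Perm.inv_eq_iff_eq, hfix _ ((isInvBlock_cycleBlock g i l).2 hl)]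
    rw [h2, Equiv.Perm.inv_def, Equiv.symm_apply_apply] at h1
    linarith
  have hconst : ∀ l ∈ cycleBlock g i, midVec (g ^ k) l = midVec (g ^ k) i := by
    intro l hl
    obtain ⟨q, rfl⟩ := (mem_cycleBlock.1 hl).exists_nat_pow_eq
    clear hl
    induction q with
    | zero => rfl
    | succ q ih =>
      rw [pow_succ', Equiv.Perm.mul_apply,
        hstep _ (show (g.right ^ q) i ∈ cycleBlock g i from mem_cycleBlock.2 ⟨q, by simp⟩), ih]
  have hsum := ((isInvBlock_cycleBlock g i).zpow k).2
  rw [h0, mul_zero, blockSum, Finset.sum_congr rfl hconst, Finset.sum_const, nsmul_eq_mul,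
    mul_eq_zero] at hsum
  refine hsum.resolve_left ?_
  rw [Nat.cast_eq_zero, Finset.card_eq_zero]
  exact Finset.ne_empty_of_mem (self_mem_cycleBlock g i)

/-- On a cycle with translation sum `0`, the translation part is the coboundary of a potential. -/
theorem exists_potential {g : Mid n} {i : Fin n} (h0 : blockSum (cycleBlock g i) g = 0) :
    ∃ φ : Fin n → ℤ, ∀ l ∈ cycleBlock g i, φ (g.right l) = midVec g (g.right l) + φ l := by
  have hex : ∀ l ∈ cycleBlock g i, ∃ k : ℤ, (g.right ^ k) i = l := fun l hl => mem_cycleBlock.1 hl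
  choose! k hk using hex
  have hwell : ∀ a b : ℤ, (g.right ^ a) i = (g.right ^ b) i →
      midVec (g ^ a) ((g.right ^ a) i) = midVec (g ^ b) ((g.right ^ b) i) := by
    intro a b hab
    have hc : (g.right ^ (b - a)) i = i := by
      rw [sub_eq_neg_add, zpow_add, Equiv.Perm.mul_apply, ← hab, ← Equiv.Perm.mul_apply, ← zpow_add]
      simp
    have h1 : g ^ b = g ^ a * g ^ (b - a) := by rw [← zpow_add]; congr 1; ring
    rw [← hab, h1, midVec_mul, right_zpow, Equiv.Perm.inv_def, Equiv.symm_apply_apply,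
      midVec_zpow_eq_zero h0 hc, add_zero]
  refine ⟨fun l => midVec (g ^ k l) l, fun l hl => ?_⟩
  have hl' := (isInvBlock_cycleBlock g i l).2 hl
  have h1 : (g.right ^ (1 + k l)) i = g.right l := by
    rw [zpow_add, zpow_one, Equiv.Perm.mul_apply, hk l hl]
  have h2 := hwell (k (g.right l)) (1 + k l) (by rw [hk _ hl', h1])
  rw [hk _ hl', h1, zpow_add, zpow_one, midVec_mul, Equiv.Perm.inv_def,
    Equiv.symm_apply_apply] at h2
  exact h2

theorem exists_mem_fixSpace_support_cycleBlock (z : ℚˣ) {g : Mid n} {i : Fin n}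
    (h0 : blockSum (cycleBlock g i) g = 0) :
    ∃ f ∈ fixSpace z g, ∀ l, f l ≠ 0 ↔ l ∈ cycleBlock g i := by
  obtain ⟨φ, hφ⟩ := exists_potential h0
  refine ⟨fun l => if l ∈ cycleBlock g i then ((z ^ φ l : ℚˣ) : ℚ) else 0, fun l => ?_,
    fun l => by simp [zpow_ne_zero]⟩
  simp only [isInvBlock_cycleBlock g i l]
  split_ifs with hl
  · rw [hφ l hl, zpow_add, Units.val_mul]
  · simp

theorem prod_zpow_eq_zpow_sum {ι H : Type*} [CommGroup H] (z : H) (v : ι → ℤ) (S : Finset ι) :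
    ∏ l ∈ S, z ^ v l = z ^ ∑ l ∈ S, v l := by
  induction S using Finset.cons_induction with
  | empty => simp
  | cons a S ha ih => rw [Finset.prod_cons, Finset.sum_cons, zpow_add, ih]

/-- A fixed vector that vanishes nowhere on an invariant block forces the block sum to be even. -/
theorem even_blockSum {g : Mid n} {S : Finset (Fin n)} (hS : IsInvBlock S g) {f : Fin n → ℚ}
    (hf : f ∈ fixSpace (-1) g) (hne : ∀ l ∈ S, f l ≠ 0) : Even (blockSum S g) := by
  have h1 : ∏ l ∈ S, f (g.right l) = ∏ l ∈ S, f l :=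
    Finset.prod_equiv g.right (fun l => (hS l).symm) fun l _ => rfl
  have h2 : ∏ l ∈ S, (((-1 : ℚˣ) ^ midVec g (g.right l) : ℚˣ) : ℚ) =
      (((-1 : ℚˣ) ^ blockSum S g : ℚˣ) : ℚ) := by
    rw [Finset.prod_equiv (t := S) (g := fun l => (((-1 : ℚˣ) ^ midVec g l : ℚˣ) : ℚ)) g.right
      (fun l => (hS l).symm) fun l _ => rfl, ← Units.coe_prod, prod_zpow_eq_zpow_sum]
    rfl
  rw [Finset.prod_congr rfl fun l _ => hf l, Finset.prod_mul_distrib, h2] at h1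
  have h3 := mul_eq_right₀ (Finset.prod_ne_zero_iff.2 hne) |>.1 h1
  rw [Units.val_eq_one] at h3
  by_contra hodd
  rw [Int.not_even_iff_odd] at hodd
  rw [hodd.neg_one_zpow] at h3
  norm_num [Units.ext_iff] at h3

theorem IsBalanced.sameCycle {g : Mid n} (hg : IsBalanced g) {i j : Fin n} (hij : i ≠ j) {k : ℤ}
    (hfix : fixSpace (-1) g ≤ fixSpace (-1) (midRefl i j k)) : g.right.SameCycle i j := by
  by_contra hc
  have hi : blockSum (cycleBlock g i) g ≠ 0 := by
    intro h0
    obtain ⟨f, hf, hsupp⟩ := exists_mem_fixSpace_support_cycleBlock (-1) h0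
    have h1 := (mem_fixSpace_midRefl hij).1 (hfix hf)
    have h2 : f j = 0 := by
      by_contra h
      exact hc (mem_cycleBlock.1 ((hsupp j).1 h))
    exact (hsupp i).2 (self_mem_cycleBlock g i) (by rw [h1, h2, mul_zero])
  have hj : blockSum (cycleBlock g j) g ≠ 0 := by
    intro h0
    obtain ⟨f, hf, hsupp⟩ := exists_mem_fixSpace_support_cycleBlock (-1) h0
    have h1 := (mem_fixSpace_midRefl hij).1 (hfix hf)
    have h2 : f i = 0 := by
      by_contra h
      exact hc (mem_cycleBlock.1 ((hsupp i).1 h)).symm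
    refine (hsupp j).2 (self_mem_cycleBlock g j) ?_
    rw [h2] at h1
    exact (mul_eq_zero.1 h1.symm).resolve_left (Units.ne_zero _)
  have hdisj : Disjoint (cycleBlock g i) (cycleBlock g j) := by
    rw [Finset.disjoint_left]
    intro l h1 h2
    exact hc ((mem_cycleBlock.1 h1).trans (mem_cycleBlock.1 h2).symm)
  have h1 := hg _ (isInvBlock_cycleBlock g i)
  have h2 := hg _ (isInvBlock_cycleBlock g j)
  have h3 := hg _ ((isInvBlock_cycleBlock g i).union (isInvBlock_cycleBlock g j))
  rw [blockSum_union hdisj] at h3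
  omega

theorem midRefl_mul_right (i j : Fin n) (k : ℤ) (g : Mid n) :
    (midRefl i j k * g).right = Equiv.swap i j * g.right := rfl

/-- A block invariant under `r * g` and under the reflection `r` is invariant under `g`. -/
theorem isInvBlock_of_midRefl_mul {S : Finset (Fin n)} {i j : Fin n} {k : ℤ} {g : Mid n}
    (hS : IsInvBlock S (midRefl i j k * g)) (h : i ∈ S ↔ j ∈ S) :
    IsInvBlock S g ∧ blockSum S (midRefl i j k * g) = blockSum S g := by
  have hr := isInvBlock_midRefl (k := k) h
  refine ⟨?_, ?_⟩
  · have := (isInvBlock_inv hr).mul hS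
    rwa [inv_mul_cancel_left] at this
  · rw [blockSum_mul hr, blockSum_midRefl]
    simp [h]

theorem IsBalanced.exists_midTrans {g : Mid n} (hg : IsBalanced g) {i : Fin n}
    (hfix : ∀ f ∈ fixSpace (-1) g, f i = 0) : IsBalanced ((midTrans i 1)⁻¹ * g) := by
  intro S hS
  have hr : ∀ T, IsInvBlock T (midTrans i 1)⁻¹ := fun T l => by simp
  have hS' : IsInvBlock S g := fun l => by simpa using hS l
  rw [blockSum_mul (hr S), midTrans_inv, blockSum_midTrans]
  split_ifs with hi
  · have h0 : blockSum (cycleBlock g i) g ≠ 0 := by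
      intro h0
      obtain ⟨f, hf, hsupp⟩ := exists_mem_fixSpace_support_cycleBlock (-1) h0
      exact (hsupp i).2 (self_mem_cycleBlock g i) (hfix f hf)
    have h1 := hg _ (isInvBlock_cycleBlock g i)
    have h2 := hg _ (hS'.sdiff (isInvBlock_cycleBlock g i))
    rw [blockSum_sdiff (hS'.cycleBlock_subset hi)] at h2
    have h3 := hg _ hS'
    omega
  · simpa using hg _ hS'

theorem IsBalanced.exists_midRefl {g : Mid n} (hg : IsBalanced g) {i j : Fin n} (hij : i ≠ j)
    {k₀ : ℤ} (hfix : fixSpace (-1) g ≤ fixSpace (-1) (midRefl i j k₀)) :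
    ∃ k, Even (k - k₀) ∧ IsBalanced (midRefl i j k * g) := by
  have hcyc := hg.sameCycle hij hfix
  have hsplit := not_sameCycle_swap_mul hij hcyc
  set C := cycleBlock (midRefl i j 0 * g) i with hC
  have hiC : i ∈ C := self_mem_cycleBlock _ i
  have hjC : j ∉ C := fun h => hsplit (mem_cycleBlock.1 h)
  have hCinv : ∀ k, IsInvBlock C (midRefl i j k * g) := fun k =>
    isInvBlock_cycleBlock (midRefl i j k * g) i
  have hsum : ∀ k, blockSum C (midRefl i j k * g) = k + blockSum C (midRefl i j 0 * g) := by
    intro k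
    have h1 : midRefl i j k * g = (midRefl i j k * midRefl i j 0) * (midRefl i j 0 * g) := by
      have h0 : midRefl i j 0 * midRefl i j 0 = 1 := by
        nth_rw 1 [← midRefl_inv]
        exact inv_mul_cancel _
      rw [mul_assoc, ← mul_assoc (midRefl i j 0), h0, one_mul]
    have h2 : IsInvBlock C (midRefl i j k * midRefl i j 0) := fun l => by simp
    have h3 : blockSum C (midRefl i j k * midRefl i j 0) = k := by
      simp only [blockSum, midVec_mul, Finset.sum_add_distrib]
      have := blockSum_midRefl C i j k
      rw [blockSum] at this
      rw [this]
      simp [hiC, hjC, midVec_midRefl]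
    rw [h1, blockSum_mul h2, h3]
  have hT := isInvBlock_cycleBlock g i
  have hTij : i ∈ cycleBlock g i ↔ j ∈ cycleBlock g i :=
    iff_of_true (self_mem_cycleBlock g i) (mem_cycleBlock.2 hcyc)
  have hTk : ∀ k, IsInvBlock (cycleBlock g i) (midRefl i j k * g) := fun k =>
    (isInvBlock_midRefl hTij).mul hT
  have hCT : C ⊆ cycleBlock g i := (hTk 0).cycleBlock_subset (self_mem_cycleBlock g i)
  have hTsum := hg _ hT
  obtain ⟨k, hk, hkC⟩ : ∃ k, Even (k - k₀) ∧ (blockSum C (midRefl i j k * g) = 0 ∨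
      blockSum C (midRefl i j k * g) = 1) := by
    rcases Int.even_or_odd (k₀ + blockSum C (midRefl i j 0 * g)) with h | h
    · refine ⟨-blockSum C (midRefl i j 0 * g), ?_, Or.inl ?_⟩
      · rw [← neg_add', even_neg, add_comm]; exact h
      · rw [hsum]; ring
    · refine ⟨1 - blockSum C (midRefl i j 0 * g), ?_, Or.inr ?_⟩
      · obtain ⟨q, hq⟩ := h
        exact ⟨-q, by linarith⟩
      · rw [hsum]; ring
  have hzero : blockSum (cycleBlock g i) g = 0 → blockSum C (midRefl i j k * g) = 0 := by
    intro h0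
    refine hkC.resolve_right fun h1 => ?_
    obtain ⟨f, hf, hsupp⟩ := exists_mem_fixSpace_support_cycleBlock (-1) h0
    have hfr : f ∈ fixSpace (-1) (midRefl i j k) := by
      have h2 := (mem_fixSpace_midRefl hij).1 (hfix hf)
      rw [mem_fixSpace_midRefl hij, h2]
      have h3 : k = k₀ + (k - k₀) := by ring
      rw [h3, zpow_add, hk.neg_one_zpow, mul_one]
    have h4 := even_blockSum (hCinv k) (mul_mem_fixSpace hfr hf) fun l hl => (hsupp l).2 (hCT hl)
    rw [h1] at h4
    exact absurd h4 (by decide)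
  refine ⟨k, hk, fun S hS => ?_⟩
  by_cases hiS : i ∈ S
  · by_cases hjS : j ∈ S
    · obtain ⟨h1, h2⟩ := isInvBlock_of_midRefl_mul hS (iff_of_true hiS hjS)
      rw [h2]
      exact hg _ h1
    · have hCS : C ⊆ S := hS.cycleBlock_subset hiS
      obtain ⟨h1, h2⟩ := isInvBlock_of_midRefl_mul (hS.sdiff (hCinv k))
        (iff_of_false (by simp [hiC]) (by simp [hjS]))
      have hdisj : Disjoint (S \ C) (cycleBlock g i) := by
        rw [Finset.disjoint_left]
        intro l hl hlT
        have h3 := h1.cycleBlock_subset hl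
        have h4 : i ∈ cycleBlock g l := mem_cycleBlock.2 (mem_cycleBlock.1 hlT).symm
        exact (Finset.mem_sdiff.1 (h3 h4)).2 hiC
      have h5 := hg _ h1
      have h6 := hg _ (h1.union hT)
      rw [blockSum_union hdisj] at h6
      rw [blockSum_sdiff hCS] at h2
      omega
  · by_cases hjS : j ∈ S
    · have hdisj : Disjoint S C := by
        rw [Finset.disjoint_left]
        intro l hl hlC
        have h3 := hS.cycleBlock_subset hl
        exact hiS (h3 (mem_cycleBlock.2 (mem_cycleBlock.1 hlC).symm))
      obtain ⟨h1, h2⟩ := isInvBlock_of_midRefl_mul (hS.union (hCinv k))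
        (iff_of_true (by simp [hiC]) (by simp [hjS]))
      have hTS : cycleBlock g i ⊆ S ∪ C := h1.cycleBlock_subset (by simp [hiC])
      have h5 := hg _ h1
      have h6 := hg _ (h1.sdiff hT)
      rw [blockSum_sdiff hTS] at h6
      rw [blockSum_union hdisj] at h2
      omega
    · obtain ⟨h1, h2⟩ := isInvBlock_of_midRefl_mul hS (iff_of_false hiS hjS)
      rw [h2]
      exact hg _ h1

theorem isInvBlock_singleton {g : Mid n} {i : Fin n} (h : g.right i = i) : IsInvBlock {i} g := by
  intro l
  rw [Finset.mem_singleton, Finset.mem_singleton]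
  nth_rw 1 [← h]
  exact g.right.injective.eq_iff

theorem IsBalanced.midRefl_mul_of_apply_eq {g : Mid n} (hg : IsBalanced g) {i j : Fin n} {k : ℤ}
    (hfix : (midRefl i j k * g).right i = i)
    (h0 : midVec (midRefl i j k * g) i = 0) : IsBalanced (midRefl i j k * g) := by
  intro S hS
  have hinv := isInvBlock_singleton hfix
  have hsum : blockSum {i} (midRefl i j k * g) = 0 := by simpa [blockSum] using h0
  by_cases hj : j ∈ S
  · obtain ⟨h1, h2⟩ := isInvBlock_of_midRefl_mul (hS.union hinv)
      (iff_of_true (by simp) (by simp [hj]))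
    have h3 := hg _ h1
    by_cases hi : i ∈ S
    · rw [Finset.union_eq_left.2 (by simpa using hi)] at h2 h3
      rwa [h2]
    · rw [blockSum_union (by simpa using hi), hsum, add_zero] at h2
      rwa [h2]
  · obtain ⟨h1, h2⟩ := isInvBlock_of_midRefl_mul (hS.sdiff hinv)
      (iff_of_false (by simp) (by simp [hj]))
    have h3 := hg _ h1
    by_cases hi : i ∈ S
    · rw [blockSum_sdiff (by simpa using hi), hsum, sub_zero] at h2
      rwa [h2]
    · rw [Finset.sdiff_eq_self_of_disjoint (by simpa using hi)] at h2 h3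
      rwa [h2]

theorem IsBalanced.eq_one_or_midTrans {g : Mid n} (hg : IsBalanced g) (hright : g.right = 1) :
    g = 1 ∨ ∃ i, g = midTrans i 1 := by
  have hinv : ∀ S, IsInvBlock S g := fun S l => by rw [hright, Equiv.Perm.one_apply]
  by_cases h0 : ∀ l, midVec g l = 0
  · exact Or.inl (mid_ext h0 hright)
  · push Not at h0
    obtain ⟨i, hi⟩ := h0
    have h1 := hg {i} (hinv _)
    simp only [blockSum, Finset.sum_singleton] at h1
    refine Or.inr ⟨i, mid_ext (fun l => ?_) hright⟩
    rw [midVec_midTrans]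
    split_ifs with hl
    · rw [hl]
      exact h1.resolve_left hi
    · have h2 := hg {l} (hinv _)
      have h3 := hg {i, l} (hinv _)
      simp only [blockSum, Finset.sum_singleton, Finset.sum_pair (Ne.symm hl)] at h2 h3
      omega

theorem IsBalanced.exists_word {g : Mid n} (hg : IsBalanced g) :
    ∃ l : List (Mid n), (∀ x ∈ l, x ∈ midGens n) ∧ l.prod = g ∧ l.length ≤ fixCodim g := by
  induction hd : fixCodim g using Nat.strong_induction_on generalizing g with
  | _ d ih =>
  subst hd
  by_cases hright : g.right = 1
  · rcases hg.eq_one_or_midTrans hright with rfl | ⟨i, rfl⟩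
    · exact ⟨[], by simp, rfl, by simp⟩
    · refine ⟨[midTrans i 1], fun x hx => ?_, by simp, ?_⟩
      · rw [List.mem_singleton.1 hx]
        exact mem_midGens_iff.2 (Or.inl ⟨i, Or.inl rfl⟩)
      have hne : fixSpace (-1) (midTrans i 1) ≠ ⊤ := by
        intro htop
        have h1 : Pi.single i 1 ∈ fixSpace (-1) (midTrans i 1) := htop ▸ Submodule.mem_top
        have h2 := h1 i
        rw [midTrans_right, Equiv.Perm.one_apply] at h2
        norm_num [midVec_midTrans] at h2
      have h3 := Submodule.finrank_lt hne
      simp only [Module.finrank_fintype_fun_eq_card, Fintype.card_fin] at h3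
      simp only [fixCodim, List.length_singleton]
      omega
  · obtain ⟨i, hi⟩ : ∃ i, g.right i ≠ i := by
      by_contra h
      push Not at h
      exact hright (Equiv.ext h)
    set j := g.right i with hj
    set x := midRefl i j (-midVec g j) with hx
    have hxi : (x * g).right i = i := by
      rw [hx, midRefl_mul_right, Equiv.Perm.mul_apply, ← hj, Equiv.swap_apply_right]
    have hx0 : midVec (x * g) i = 0 := by
      rw [midVec_mul, hx, midVec_midRefl]
      simp [hi.symm]
    have hfix : fixSpace (-1) g ≤ fixSpace (-1) x := by
      intro f hf
      rw [hx, mem_fixSpace_midRefl hi.symm, hj, hf i, ← mul_assoc, ← Units.val_mul, ← zpow_add]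
      simp
    have hlt : fixSpace (-1) g < fixSpace (-1) (x * g) := by
      refine lt_of_le_of_ne (fun f hf => mul_mem_fixSpace (hfix hf) hf) fun heq => ?_
      have h1 : Pi.single i 1 ∈ fixSpace (-1) (x * g) := by
        intro l
        by_cases hl : l = i
        · rw [hl, hxi, hx0]
          simp
        · have : (x * g).right l ≠ i := fun h => hl ((x * g).right.injective (h.trans hxi.symm))
          rw [Pi.single_eq_of_ne this, Pi.single_eq_of_ne hl, mul_zero]
      rw [← heq] at h1
      have h2 := h1 i
      rw [← hj, Pi.single_eq_of_ne hi, Pi.single_eq_same, mul_one] at h2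
      exact Units.ne_zero _ h2.symm
    have hcod : fixCodim (x * g) < fixCodim g := by
      have h1 := Submodule.finrank_lt_finrank_of_lt hlt
      have h2 := finrank_fixSpace_le (-1) (x * g)
      unfold fixCodim
      omega
    obtain ⟨l, hl, hprod, hlen⟩ :=
      ih _ hcod (hg.midRefl_mul_of_apply_eq hxi hx0) rfl
    refine ⟨x :: l, ?_, ?_, ?_⟩
    · intro y hy
      rcases List.mem_cons.1 hy with rfl | hy
      · exact mem_midGens_iff.2 (Or.inr ⟨i, j, _, hi.symm, rfl⟩)
      · exact hl y hy
    · rw [List.prod_cons, hprod, ← mul_assoc]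
      nth_rw 1 [hx, ← midRefl_inv, ← hx]
      rw [inv_mul_cancel, one_mul]
    · rw [List.length_cons]
      omega

theorem midToCoxB_eq_iff {x y : Mid n} : midToCoxB n x = midToCoxB n y ↔
    x.right = y.right ∧ ∀ l, (midVec x l : ZMod 2) = midVec y l := by
  constructor
  · intro h
    exact ⟨congrArg (fun z : CoxB n => z.right) h,
      fun l => congrFun (congrArg (fun z : CoxB n => toAdd z.left) h) l⟩
  · rintro ⟨h1, h2⟩
    exact SemidirectProduct.ext (Multiplicative.toAdd.injective (funext h2)) h1

theorem intCast_zmod_two_eq_iff {a b : ℤ} : (a : ZMod 2) = b ↔ Even (a - b) := by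
  rw [← sub_eq_zero, ← Int.cast_sub, ZMod.intCast_zmod_eq_zero_iff_dvd, even_iff_two_dvd]
  norm_num

theorem fixSpace_neg_one_eq_of_midToCoxB_eq {x y : Mid n} (h : midToCoxB n x = midToCoxB n y) :
    fixSpace (-1) x = fixSpace (-1) y := by
  obtain ⟨h1, h2⟩ := midToCoxB_eq_iff.1 h
  have h3 : ∀ l, (-1 : ℚˣ) ^ midVec x l = (-1) ^ midVec y l := by
    intro l
    have h4 : midVec x l = midVec y l + (midVec x l - midVec y l) := by ring
    rw [h4, zpow_add, (intCast_zmod_two_eq_iff.1 (h2 l)).neg_one_zpow, mul_one]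
  ext f
  simp only [mem_fixSpace, h1, h3]

theorem exists_eq_midTrans_of_right_eq_one {x : Mid n} (hx : x ∈ midGens n) (h : x.right = 1) :
    ∃ i c, (c = 1 ∨ c = -1) ∧ x = midTrans i c := by
  rcases mem_midGens_iff.1 hx with ⟨i, rfl | rfl⟩ | ⟨i, j, k, hij, rfl⟩
  · exact ⟨i, 1, Or.inl rfl, rfl⟩
  · exact ⟨i, -1, Or.inr rfl, rfl⟩
  · exact absurd (Equiv.swap_eq_one_iff.1 h) hij

theorem exists_eq_midRefl_of_right_eq_swap {x : Mid n} (hx : x ∈ midGens n) {i j : Fin n}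
    (hij : i ≠ j) (h : x.right = Equiv.swap i j) : ∃ k, x = midRefl i j k := by
  rcases mem_midGens_iff.1 hx with ⟨a, rfl | rfl⟩ | ⟨a, b, k, hab, rfl⟩
  · exact absurd (Equiv.swap_eq_one_iff.1 h.symm) hij
  · exact absurd (Equiv.swap_eq_one_iff.1 h.symm) hij
  · have h1 : Equiv.swap a b i = j := by
      rw [midRefl_right] at h
      rw [h, Equiv.swap_apply_left]
    rw [Equiv.swap_apply_def] at h1
    split_ifs at h1 with h2 h3
    · exact ⟨k, by rw [h2, ← h1]⟩
    · exact ⟨-k, by rw [h3, ← h1, midRefl_comm]⟩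
    · exact absurd h1 hij

theorem IsBalanced.lift_unique {g x y : Mid n} (hg : IsBalanced g) (hx : x ∈ midGens n)
    (hy : y ∈ midGens n) (hxy : midToCoxB n x = midToCoxB n y)
    (hfix : fixSpace (-1) g ≤ fixSpace (-1) x) (hbx : IsBalanced (x⁻¹ * g))
    (hby : IsBalanced (y⁻¹ * g)) : x = y := by
  obtain ⟨hright, hvec⟩ := midToCoxB_eq_iff.1 hxy
  by_cases h1 : x.right = 1
  · obtain ⟨i, c, hc, rfl⟩ := exists_eq_midTrans_of_right_eq_one hx h1
    obtain ⟨j, d, hd, rfl⟩ := exists_eq_midTrans_of_right_eq_one hy (hright ▸ h1)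
    have hv := intCast_zmod_two_eq_iff.1 (hvec i)
    have hij : i = j := by
      by_contra hij
      simp only [midVec_midTrans, if_true, if_neg hij] at hv
      rcases hc with rfl | rfl <;> exact absurd hv (by decide)
    subst hij
    have h2 := hbx _ (isInvBlock_univ _)
    have h3 := hby _ (isInvBlock_univ _)
    rw [midTrans_inv, blockSum_mul (isInvBlock_univ _), blockSum_midTrans,
      if_pos (Finset.mem_univ _)] at h2 h3
    have : c = d := by omega
    rw [this]
  · obtain ⟨i, j, k, hij, rfl⟩ : ∃ i j k, i ≠ j ∧ x = midRefl i j k := by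
      rcases mem_midGens_iff.1 hx with ⟨i, rfl | rfl⟩ | h
      exacts [absurd rfl h1, absurd rfl h1, h]
    obtain ⟨m, rfl⟩ := exists_eq_midRefl_of_right_eq_swap hy hij hright.symm
    have hv := intCast_zmod_two_eq_iff.1 (hvec i)
    simp only [midVec_midRefl, if_true, if_neg hij, sub_zero, mul_one] at hv
    have hsplit := not_sameCycle_swap_mul hij (hg.sameCycle hij hfix)
    have hinv : ∀ q, IsInvBlock (cycleBlock (midRefl i j k * g) i) (midRefl i j q * g) := fun q =>
      isInvBlock_cycleBlock (midRefl i j q * g) i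
    rw [midRefl_inv] at hbx hby
    have h2 := hbx _ (hinv k)
    have h3 := hby _ (hinv m)
    have hi : i ∈ cycleBlock (midRefl i j k * g) i := self_mem_cycleBlock _ i
    have hj : j ∉ cycleBlock (midRefl i j k * g) i := fun h => hsplit (mem_cycleBlock.1 h)
    have h4 : ∀ q, blockSum (cycleBlock (midRefl i j k * g) i) (midRefl i j q * g) =
        q + ∑ l ∈ cycleBlock (midRefl i j k * g) i, midVec g (Equiv.swap i j l) := by
      intro q
      have h5 := blockSum_midRefl (cycleBlock (midRefl i j k * g) i) i j q
      rw [if_pos hi, if_neg hj, blockSum] at h5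
      simp only [blockSum, midVec_mul, Finset.sum_add_distrib, midRefl_right, Equiv.swap_inv]
      rw [h5]
      ring
    rw [h4] at h2 h3
    obtain ⟨q, hq⟩ := hv
    have : k = m := by omega
    rw [this]

theorem le_finrank_fixList_one_add_countP {l : List (Mid n)} (hl : ∀ x ∈ l, x ∈ midGens n) :
    n ≤ Module.finrank ℚ (fixList 1 l) + l.countP (fun x => x.right ≠ 1) := by
  have h1 := le_finrank_fixList_add_length 1 (l.filter fun x => x.right ≠ 1) fun x hx =>
    exists_functional_of_mem_midGens 1 (hl x (List.mem_filter.1 hx).1)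
  have h2 : fixList 1 (l.filter fun x => x.right ≠ 1) ≤ fixList 1 l := by
    intro f hf
    rw [mem_fixList] at hf ⊢
    intro x hx
    by_cases hr : x.right = 1
    · intro k
      simp [hr]
    · exact hf x (List.mem_filter.2 ⟨hx, by simpa using hr⟩)
  have h3 := Submodule.finrank_mono h2
  rw [List.countP_eq_length_filter]
  omega

theorem blockSum_eq_zero_of_right_ne_one {S : Finset (Fin n)} {x : Mid n} (hx : x ∈ midGens n)
    (h : x.right ≠ 1) (hS : IsInvBlock S x) : blockSum S x = 0 := by
  rcases mem_midGens_iff.1 hx with ⟨i, rfl | rfl⟩ | ⟨i, j, k, hij, rfl⟩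
  · exact absurd rfl h
  · exact absurd rfl h
  · have h1 := hS i
    rw [midRefl_right, Equiv.swap_apply_left] at h1
    rw [blockSum_midRefl]
    simp [h1]

theorem blockSum_prod_eq_sum_filter {S : Finset (Fin n)} {l : List (Mid n)}
    (hl : ∀ x ∈ l, x ∈ midGens n) (hS : ∀ x ∈ l, IsInvBlock S x) :
    blockSum S l.prod = ((l.filter fun x => x.right = 1).map (blockSum S)).sum := by
  induction l with
  | nil => simp [blockSum]
  | cons x l ih =>
    rw [List.prod_cons, blockSum_mul (hS x (by simp)),
      ih (fun y hy => hl y (by simp [hy])) (fun y hy => hS y (by simp [hy]))]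
    by_cases hr : x.right = 1
    · simp [hr]
    · simp [hr, blockSum_eq_zero_of_right_ne_one (hl x (by simp)) hr (hS x (by simp))]

/-- If the permutation part of `w` is an `n`-cycle and its translation sum is `1`, then every
factor of a word of length at most `n` for `w` is balanced. -/
theorem isBalanced_of_factor {w : Mid n} (hfix : Module.finrank ℚ (fixSpace 1 w) ≤ 1)
    (hsum : blockSum Finset.univ w = 1) {l₁ l₂ l₃ : List (Mid n)}
    (hl : ∀ x ∈ l₁ ++ l₂ ++ l₃, x ∈ midGens n) (hprod : (l₁ ++ l₂ ++ l₃).prod = w)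
    (hlen : (l₁ ++ l₂ ++ l₃).length ≤ n) : IsBalanced l₂.prod := by
  have hg₁ : ∀ x ∈ l₁, x ∈ midGens n := fun x hx => hl x (by simp [hx])
  have hg₂ : ∀ x ∈ l₂, x ∈ midGens n := fun x hx => hl x (by simp [hx])
  have hg₃ : ∀ x ∈ l₃, x ∈ midGens n := fun x hx => hl x (by simp [hx])
  have hd₁ := le_finrank_fixList_one_add_countP hg₁
  have hd₂ := le_finrank_fixList_one_add_countP hg₂
  have hd₃ := le_finrank_fixList_one_add_countP hg₃
  have hle : fixList 1 l₁ ⊓ fixSpace 1 l₂.prod ⊓ fixList 1 l₃ ≤ fixSpace 1 w := by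
    rintro f ⟨⟨h1, h2⟩, h3⟩
    rw [← hprod, List.prod_append, List.prod_append]
    exact mul_mem_fixSpace (mul_mem_fixSpace (fixList_le_fixSpace_prod 1 l₁ h1) h2)
      (fixList_le_fixSpace_prod 1 l₃ h3)
  have hfin : ∀ V : Submodule ℚ (Fin n → ℚ), Module.finrank ℚ V ≤ n := fun V => by
    simpa using V.finrank_le
  have e1 := Submodule.finrank_sup_add_finrank_inf_eq (fixList 1 l₁) (fixSpace 1 l₂.prod)
  have e2 := Submodule.finrank_sup_add_finrank_inf_eq
    (fixList 1 l₁ ⊓ fixSpace 1 l₂.prod) (fixList 1 l₃)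
  have e3 := Submodule.finrank_mono hle
  have e4 := hfin (fixList 1 l₁ ⊔ fixSpace 1 l₂.prod)
  have e5 := hfin (fixList 1 l₁ ⊓ fixSpace 1 l₂.prod ⊔ fixList 1 l₃)
  have e6 := Submodule.finrank_mono (fixList_le_fixSpace_prod 1 l₂)
  have htot := le_finrank_fixList_one_add_countP hl
  have e7 := Submodule.finrank_mono (fixList_le_fixSpace_prod 1 (l₁ ++ l₂ ++ l₃))
  rw [hprod] at e7
  have hcount := (l₁ ++ l₂ ++ l₃).length_eq_countP_add_countP (fun x => x.right ≠ 1)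
  have hcount' : (l₁ ++ l₂ ++ l₃).countP (fun x => x.right ≠ 1) =
    l₁.countP (fun x => x.right ≠ 1) + l₂.countP (fun x => x.right ≠ 1) +
      l₃.countP (fun x => x.right ≠ 1) := by
    rw [List.countP_append, List.countP_append]
  have hlf : ((l₁ ++ l₂ ++ l₃).filter fun x => x.right = 1).length =
      (l₁ ++ l₂ ++ l₃).countP (fun x => ¬ (decide (x.right ≠ 1) = true)) := by
    rw [List.countP_eq_length_filter]
    congr 2
    funext x
    simp
  have hfl : ((l₁ ++ l₂ ++ l₃).filter fun x => x.right = 1).length ≤ 1 := by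
    rw [hlf]
    omega
  obtain ⟨i, hi⟩ : ∃ i, ((l₁ ++ l₂ ++ l₃).filter fun x => x.right = 1) = [midTrans i 1] := by
    have h1 := blockSum_prod_eq_sum_filter hl fun x _ => isInvBlock_univ x
    rw [hprod, hsum] at h1
    rcases Nat.le_one_iff_eq_zero_or_eq_one.1 hfl with h | h
    · rw [List.length_eq_zero_iff.1 h] at h1
      simp at h1
    · obtain ⟨t, ht⟩ := List.length_eq_one_iff.1 h
      have htm := List.mem_filter.1 (ht ▸ List.mem_singleton_self t)
      obtain ⟨i, c, hc, rfl⟩ :=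
        exists_eq_midTrans_of_right_eq_one (hl t htm.1) (by simpa using htm.2)
      rw [ht] at h1
      simp [blockSum_midTrans] at h1
      exact ⟨i, by rw [ht, ← h1]⟩
  have hsub : (l₂.filter fun x => x.right = 1).Sublist [midTrans i 1] := by
    rw [← hi]
    refine List.Sublist.filter _ ?_
    exact (List.sublist_append_right l₁ l₂).trans (List.sublist_append_left _ l₃)
  rw [hi, List.length_singleton] at hlf
  intro S hS
  have heq : fixList 1 l₂ = fixSpace 1 l₂.prod :=
    Submodule.eq_of_le_of_finrank_le (fixList_le_fixSpace_prod 1 l₂) (by omega)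
  have hind : (fun l => if l ∈ S then (1 : ℚ) else 0) ∈ fixList 1 l₂ := by
    rw [heq]
    intro l
    simp [hS l]
  have hS' : ∀ x ∈ l₂, IsInvBlock S x := by
    intro x hx l
    have h1 := mem_fixList.1 hind x hx l
    by_cases ha : x.right l ∈ S <;> by_cases hb : l ∈ S <;> simp_all
  rw [blockSum_prod_eq_sum_filter hg₂ hS']
  rcases List.sublist_singleton.1 hsub with h | h
  · rw [h]; simp
  · rw [h]
    simp only [List.map_singleton, List.sum_singleton, blockSum_midTrans]
    split_ifs <;> simp

theorem midToCoxB_surjective : Function.Surjective (midToCoxB n) := by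
  intro h
  refine ⟨⟨ofAdd fun i => ((toAdd h.left i).val : ℤ), h.right⟩,
    SemidirectProduct.ext (Multiplicative.toAdd.injective (funext fun i => ?_)) rfl⟩
  change (((toAdd h.left i).val : ℤ) : ZMod 2) = toAdd h.left i
  simp

theorem conj_mem_midGens {x : Mid n} (hx : x ∈ midGens n) (g : Mid n) :
    g * x * g⁻¹ ∈ midGens n := by
  rw [mem_midGens_iff] at hx ⊢
  have hT : ∀ i c, g * midTrans i c * g⁻¹ = midTrans (g.right i) c := by
    intro i c
    refine mid_ext (fun l => ?_) (by simp)
    simp [midVec_mul, midVec_inv, midVec_midTrans, Equiv.symm_apply_eq, Equiv.Perm.inv_def]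
  rcases hx with ⟨i, rfl | rfl⟩ | ⟨i, j, k, hij, rfl⟩
  · exact Or.inl ⟨g.right i, Or.inl (hT i 1)⟩
  · exact Or.inl ⟨g.right i, Or.inr (hT i (-1))⟩
  · refine Or.inr ⟨g.right i, g.right j, k + midVec g (g.right i) - midVec g (g.right j),
      by simpa using hij, mid_ext (fun l => ?_) ?_⟩
    · obtain ⟨l, rfl⟩ := g.right.surjective l
      simp only [midVec_mul, midVec_inv, midVec_midRefl, SemidirectProduct.mul_right,
        midRefl_right, mul_inv_rev, Equiv.Perm.mul_apply, Equiv.Perm.inv_def, Equiv.symm_swap,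
        Equiv.symm_apply_apply, g.right.injective.eq_iff]
      rw [Equiv.swap_apply_def]
      by_cases h1 : l = i
      · subst h1
        simp [hij]
        ring
      · by_cases h2 : l = j
        · subst h2
          simp [h1]
          ring
        · simp [h1, h2]
    · simp [Equiv.swap_apply_apply]

theorem mem_coxBRefl_iff {r : CoxB n} : r ∈ coxBRefl n ↔ ∃ x ∈ midGens n, midToCoxB n x = r := by
  constructor
  · rintro ⟨s, hs, g, rfl⟩
    obtain ⟨g, rfl⟩ := midToCoxB_surjective g
    obtain ⟨x, hx, rfl⟩ : ∃ x ∈ midGens n, midToCoxB n x = s := by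
      rcases hs with ⟨i, rfl⟩ | ⟨i, j, hij, rfl⟩
      · refine ⟨midTrans i 1, mem_midGens_iff.2 (Or.inl ⟨i, Or.inl rfl⟩),
          SemidirectProduct.ext (Multiplicative.toAdd.injective (funext fun l => ?_)) rfl⟩
        change ((midVec (midTrans i 1) l : ℤ) : ZMod 2) = (Pi.single i 1 : Fin n → ZMod 2) l
        simp [midVec_midTrans, Pi.single_apply]
      · refine ⟨midRefl i j 0, mem_midGens_iff.2 (Or.inr ⟨i, j, 0, hij, rfl⟩),
          SemidirectProduct.ext (Multiplicative.toAdd.injective (funext fun l => ?_)) rfl⟩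
        change ((midVec (midRefl i j 0) l : ℤ) : ZMod 2) = 0
        simp [midVec_midRefl]
    exact ⟨g * x * g⁻¹, conj_mem_midGens hx g, by simp⟩
  · rintro ⟨x, hx, rfl⟩
    rcases mem_midGens_iff.1 hx with ⟨i, h⟩ | ⟨i, j, k, hij, rfl⟩
    · refine ⟨_, Or.inl ⟨i, rfl⟩, 1, ?_⟩
      rw [one_mul, inv_one, mul_one]
      refine SemidirectProduct.ext (Multiplicative.toAdd.injective (funext fun l => ?_)) ?_
      · change ((midVec x l : ℤ) : ZMod 2) = (Pi.single i 1 : Fin n → ZMod 2) l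
        rcases h with rfl | rfl <;> simp only [midVec_midTrans, Pi.single_apply] <;>
          split_ifs <;> rfl
      · rcases h with rfl | rfl <;> rfl
    · refine ⟨_, Or.inr ⟨i, j, hij, rfl⟩, midToCoxB n (midTrans i k), ?_⟩
      have h1 : (SemidirectProduct.inr (Equiv.swap i j) : CoxB n) =
          midToCoxB n (midRefl i j 0) := by
        refine SemidirectProduct.ext (Multiplicative.toAdd.injective (funext fun l => ?_)) rfl
        change 0 = ((midVec (midRefl i j 0) l : ℤ) : ZMod 2)
        simp [midVec_midRefl]
      rw [h1, ← map_inv, ← map_mul, ← map_mul]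
      congr 1
      refine mid_ext (fun l => ?_) (by simp)
      simp only [midVec_mul, midVec_midTrans, midVec_midRefl, midTrans_inv,
        SemidirectProduct.mul_right, midTrans_right, midRefl_right, inv_one, one_mul,
        Equiv.swap_inv, Equiv.Perm.one_apply, Equiv.swap_apply_def]
      by_cases h1 : l = i
      · simp [h1, hij, hij.symm]
      · by_cases h2 : l = j
        · simp [h2, hij.symm]
        · simp [h1, h2]

theorem midToCoxB_mem_coxBRefl {x : Mid n} (hx : x ∈ midGens n) : midToCoxB n x ∈ coxBRefl n :=
  mem_coxBRefl_iff.2 ⟨x, hx, rfl⟩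

theorem exists_word_coxB (h : CoxB n) : ∃ l : List (CoxB n),
    l.length = wordLength (coxBRefl n) h ∧ (∀ r ∈ l, r ∈ coxBRefl n) ∧ l.prod = h := by
  refine exists_word_of_closure_eq_top (fun r hr => ?_) ?_ h
  · obtain ⟨x, hx, rfl⟩ := mem_coxBRefl_iff.1 hr
    exact mem_coxBRefl_iff.2 ⟨x⁻¹, inv_mem_midGens hx, map_inv _ _⟩
  · have himage : coxBRefl n = midToCoxB n '' midGens n := Set.ext fun _ => mem_coxBRefl_iff
    rw [himage, ← MonoidHom.map_closure, closure_midGens]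
    exact Subgroup.map_top_of_surjective _ midToCoxB_surjective

theorem wordLength_coxB_one : wordLength (coxBRefl n) 1 = 0 :=
  Nat.le_zero.1 (wordLength_le_length (l := []) (by simp))

theorem exists_map_midToCoxB_eq {rs : List (CoxB n)} (hrs : ∀ r ∈ rs, r ∈ coxBRefl n) :
    ∃ xs : List (Mid n), (∀ x ∈ xs, x ∈ midGens n) ∧ xs.map (midToCoxB n) = rs := by
  induction rs with
  | nil => exact ⟨[], by simp, rfl⟩
  | cons r rs ih =>
    obtain ⟨x, hx, rfl⟩ := mem_coxBRefl_iff.1 (hrs r (by simp))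
    obtain ⟨xs, hxs, rfl⟩ := ih fun r hr => hrs r (by simp [hr])
    exact ⟨x :: xs, by simpa using ⟨hx, hxs⟩, rfl⟩

theorem exists_midGens_word_coxB (h : CoxB n) : ∃ l : List (Mid n),
    l.length = wordLength (coxBRefl n) h ∧ (∀ x ∈ l, x ∈ midGens n) ∧
      midToCoxB n l.prod = h := by
  obtain ⟨rs, hlen, hrs, hprod⟩ := exists_word_coxB h
  obtain ⟨xs, hxs, rfl⟩ := exists_map_midToCoxB_eq hrs
  exact ⟨xs, by simpa using hlen, hxs, by rw [map_list_prod, hprod]⟩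

theorem wordLength_midToCoxB_le (g : Mid n) :
    wordLength (coxBRefl n) (midToCoxB n g) ≤ wordLength (midGens n) g := by
  obtain ⟨l, hlen, hl, rfl⟩ := exists_word_mid g
  rw [← hlen, map_list_prod, ← List.length_map (midToCoxB n)]
  refine wordLength_le_length fun r hr => ?_
  obtain ⟨x, hx, rfl⟩ := List.mem_map.1 hr
  exact midToCoxB_mem_coxBRefl (hl x hx)

theorem fixCodim_le_wordLength_midToCoxB (g : Mid n) :
    fixCodim g ≤ wordLength (coxBRefl n) (midToCoxB n g) := by
  obtain ⟨l, hlen, hl, hprod⟩ := exists_midGens_word_coxB (midToCoxB n g)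
  rw [← hlen, fixCodim, ← fixSpace_neg_one_eq_of_midToCoxB_eq hprod]
  exact fixCodim_prod_le_length hl

theorem IsBalanced.wordLength_le_fixCodim {g : Mid n} (hg : IsBalanced g) :
    wordLength (midGens n) g ≤ fixCodim g := by
  obtain ⟨l, hl, rfl, hlen⟩ := hg.exists_word
  exact (wordLength_le_length hl).trans hlen

theorem IsBalanced.wordLength_midToCoxB {g : Mid n} (hg : IsBalanced g) :
    wordLength (coxBRefl n) (midToCoxB n g) = wordLength (midGens n) g :=
  (wordLength_midToCoxB_le g).antisymm
    (hg.wordLength_le_fixCodim.trans (fixCodim_le_wordLength_midToCoxB g))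

theorem IsBalanced.fixSpace_le {g y : Mid n} (hg : IsBalanced g) (hy : y ∈ midGens n)
    (hlt : wordLength (coxBRefl n) ((midToCoxB n y)⁻¹ * midToCoxB n g) <
      wordLength (coxBRefl n) (midToCoxB n g)) :
    fixSpace (-1) g ≤ fixSpace (-1) y := by
  obtain ⟨l, hlen, hl, hprod⟩ := exists_midGens_word_coxB ((midToCoxB n y)⁻¹ * midToCoxB n g)
  have hyl : ∀ x ∈ y :: l, x ∈ midGens n := by simpa using ⟨hy, hl⟩
  have heq : fixSpace (-1) (y :: l).prod = fixSpace (-1) g :=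
    fixSpace_neg_one_eq_of_midToCoxB_eq (by simp [hprod])
  rw [← heq]
  refine fixSpace_prod_le_of_tight (-1) hyl ?_ (by simp)
  have h1 := hg.wordLength_le_fixCodim
  have h2 := finrank_fixSpace_le (-1) g
  rw [hg.wordLength_midToCoxB] at hlt
  rw [heq, List.length_cons]
  unfold fixCodim at h1
  omega

theorem IsBalanced.exists_lift {g : Mid n} (hg : IsBalanced g) {r : CoxB n} (hr : r ∈ coxBRefl n)
    (hlt : wordLength (coxBRefl n) (r⁻¹ * midToCoxB n g) <
      wordLength (coxBRefl n) (midToCoxB n g)) :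
    ∃ x ∈ midGens n, midToCoxB n x = r ∧ IsBalanced (x⁻¹ * g) := by
  obtain ⟨y, hy, rfl⟩ := mem_coxBRefl_iff.1 hr
  have hfix := hg.fixSpace_le hy hlt
  have hT : ∀ i c, (c = 1 ∨ c = -1) → y = midTrans i c →
      ∃ x ∈ midGens n, midToCoxB n x = midToCoxB n y ∧ IsBalanced (x⁻¹ * g) := by
    rintro i c hc rfl
    refine ⟨midTrans i 1, mem_midGens_iff.2 (Or.inl ⟨i, Or.inl rfl⟩),
      midToCoxB_eq_iff.2 ⟨rfl, fun l => ?_⟩, hg.exists_midTrans fun f hf => ?_⟩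
    · rw [intCast_zmod_two_eq_iff, midVec_midTrans, midVec_midTrans]
      rcases hc with rfl | rfl <;> split_ifs <;> decide
    · have h1 := hfix hf i
      rw [midTrans_right, Equiv.Perm.one_apply, midVec_midTrans, if_pos rfl] at h1
      rcases hc with rfl | rfl <;> norm_num at h1 <;> linarith
  rcases mem_midGens_iff.1 hy with ⟨i, h | h⟩ | ⟨i, j, k₀, hij, rfl⟩
  · exact hT i 1 (Or.inl rfl) h
  · exact hT i (-1) (Or.inr rfl) h
  · obtain ⟨k, hk, hbal⟩ := hg.exists_midRefl hij hfix
    refine ⟨midRefl i j k, mem_midGens_iff.2 (Or.inr ⟨i, j, k, hij, rfl⟩),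
      midToCoxB_eq_iff.2 ⟨rfl, fun l => ?_⟩, by rwa [midRefl_inv]⟩
    rw [intCast_zmod_two_eq_iff, midVec_midRefl, midVec_midRefl, ← sub_mul]
    exact hk.mul_right _

/-- A word in the generators of the middle group that can be stripped off `g` from the left, one
letter at a time, through balanced elements whose images in `CoxB n` get shorter. -/
def IsBalancedPath : List (Mid n) → Mid n → Prop
  | [], g => IsBalanced g
  | x :: xs, g => IsBalanced g ∧ x ∈ midGens n ∧
      wordLength (coxBRefl n) ((midToCoxB n x)⁻¹ * midToCoxB n g) <
        wordLength (coxBRefl n) (midToCoxB n g) ∧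
      IsBalancedPath xs (x⁻¹ * g)

theorem IsBalancedPath.isBalanced {xs : List (Mid n)} {g : Mid n} (h : IsBalancedPath xs g) :
    IsBalanced g := by
  cases xs with
  | nil => exact h
  | cons x xs => exact h.1

theorem IsBalancedPath.mem_midGens {xs : List (Mid n)} {g : Mid n} (h : IsBalancedPath xs g) :
    ∀ x ∈ xs, x ∈ midGens n := by
  induction xs generalizing g with
  | nil => simp
  | cons x xs ih => simpa using ⟨h.2.1, ih h.2.2.2⟩

theorem IsBalancedPath.isBalanced_prod_inv_mul {xs : List (Mid n)} {g : Mid n}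
    (h : IsBalancedPath xs g) : IsBalanced (xs.prod⁻¹ * g) := by
  induction xs generalizing g with
  | nil => simpa using h.isBalanced
  | cons x xs ih =>
    rw [List.prod_cons, mul_inv_rev, mul_assoc]
    exact ih h.2.2.2

theorem IsBalancedPath.of_append {xs ys : List (Mid n)} {g : Mid n}
    (h : IsBalancedPath (xs ++ ys) g) : IsBalancedPath xs g := by
  induction xs generalizing g with
  | nil => exact h.isBalanced
  | cons x xs ih => exact ⟨h.1, h.2.1, h.2.2.1, ih h.2.2.2⟩

theorem IsBalancedPath.eq_of_map_eq {xs ys : List (Mid n)} {g : Mid n} (hxs : IsBalancedPath xs g)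
    (hys : IsBalancedPath ys g) (h : xs.map (midToCoxB n) = ys.map (midToCoxB n)) : xs = ys := by
  induction xs generalizing ys g with
  | nil => exact (List.map_eq_nil_iff.1 h.symm).symm
  | cons x xs ih =>
    cases ys with
    | nil => simp at h
    | cons y ys =>
      rw [List.map_cons, List.map_cons, List.cons.injEq] at h
      obtain ⟨hg, hx, hlt, hxs⟩ := hxs
      obtain ⟨-, hy, -, hys⟩ := hys
      obtain rfl := hg.lift_unique hx hy h.1 (hg.fixSpace_le hx hlt) hxs.isBalanced hys.isBalanced
      rw [ih hxs hys h.2]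

theorem IsBalanced.exists_isBalancedPath {g : Mid n} (hg : IsBalanced g) {rs : List (CoxB n)}
    (hrs : ∀ r ∈ rs, r ∈ coxBRefl n)
    (hlen : wordLength (coxBRefl n) (midToCoxB n g) =
      rs.length + wordLength (coxBRefl n) (rs.prod⁻¹ * midToCoxB n g)) :
    ∃ xs, xs.map (midToCoxB n) = rs ∧ IsBalancedPath xs g := by
  induction rs generalizing g with
  | nil => exact ⟨[], rfl, hg⟩
  | cons r rs ih =>
    have hr := hrs r (by simp)
    have hrs' : ∀ r ∈ rs, r ∈ coxBRefl n := fun r hr => hrs r (by simp [hr])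
    have h1 := wordLength_mul_le exists_word_coxB rs.prod (rs.prod⁻¹ * (r⁻¹ * midToCoxB n g))
    have h2 := wordLength_mul_le exists_word_coxB r (r⁻¹ * midToCoxB n g)
    have h3 : wordLength (coxBRefl n) r ≤ 1 := by
      simpa using wordLength_le_length (S := coxBRefl n) (l := [r]) (by simpa using hr)
    have h4 := wordLength_le_length hrs'
    rw [mul_inv_cancel_left] at h1 h2
    rw [List.prod_cons, mul_inv_rev, mul_assoc, List.length_cons] at hlen
    have hlt : wordLength (coxBRefl n) (r⁻¹ * midToCoxB n g) <
      wordLength (coxBRefl n) (midToCoxB n g) := by omega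
    obtain ⟨x, hx, rfl, hbal⟩ := hg.exists_lift hr hlt
    obtain ⟨xs, rfl, hxs⟩ := ih hbal hrs' (by rw [map_mul, map_inv]; omega)
    exact ⟨x :: xs, rfl, hg, hx, hlt, hxs⟩

theorem isBalancedPath_of_geodesic {xs ys : List (Mid n)} (hl : ∀ x ∈ xs ++ ys, x ∈ midGens n)
    (hbal : ∀ l, l <:+ xs ++ ys → IsBalanced l.prod)
    (hlen : (xs ++ ys).length ≤ wordLength (midGens n) (xs ++ ys).prod) :
    IsBalancedPath xs (xs ++ ys).prod := by
  induction xs with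
  | nil => exact hbal _ List.suffix_rfl
  | cons x xs ih =>
    have hx := hl x (by simp)
    have hl' : ∀ x ∈ xs ++ ys, x ∈ midGens n := fun y hy => hl y (List.mem_cons_of_mem _ hy)
    have hg := hbal _ List.suffix_rfl
    have h1 := wordLength_mul_le exists_word_mid x (xs ++ ys).prod
    have h2 : wordLength (midGens n) x ≤ 1 := by
      simpa using wordLength_le_length (S := midGens n) (l := [x]) (by simpa using hx)
    have h3 := wordLength_midToCoxB_le (xs ++ ys).prod
    have h4 := hg.wordLength_midToCoxB
    have h5 := wordLength_le_length hl'
    rw [List.cons_append, List.length_cons, List.prod_cons] at hlen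
    rw [List.cons_append, List.prod_cons] at h4 hg ⊢
    refine ⟨hg, hx, ?_, ?_⟩
    · rw [map_mul, inv_mul_cancel_left, ← map_mul]
      omega
    · rw [inv_mul_cancel_left]
      exact ih hl' (fun l h => hbal l (h.trans (List.suffix_cons _ _))) (by omega)

/-- Every factor of every geodesic word for `w` is balanced. -/
def HasBalancedFactors (w : Mid n) : Prop :=
  ∀ l₁ l₂ l₃ : List (Mid n), (∀ x ∈ l₁ ++ l₂ ++ l₃, x ∈ midGens n) → (l₁ ++ l₂ ++ l₃).prod = w →
    (l₁ ++ l₂ ++ l₃).length = wordLength (midGens n) w → IsBalanced l₂.prod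

namespace HasBalancedFactors

variable {w u v : Mid n}

theorem isBalanced (hw : HasBalancedFactors w) : IsBalanced w := by
  obtain ⟨l, hlen, hl, hprod⟩ := exists_word_mid w
  rw [← hprod]
  exact hw [] l [] (by simpa using hl) (by simpa using hprod) (by simpa using hlen)

theorem exists_isBalancedPath (hw : HasBalancedFactors w)
    (hu : wordLength (midGens n) u + wordLength (midGens n) (u⁻¹ * w) = wordLength (midGens n) w)
    {rs : List (CoxB n)} (hrs : ∀ r ∈ rs, r ∈ coxBRefl n) (hprod : rs.prod = midToCoxB n u)
    (hlen : rs.length = wordLength (coxBRefl n) (midToCoxB n u)) :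
    ∃ xs, xs.map (midToCoxB n) = rs ∧ xs.prod = u ∧ IsBalancedPath xs w := by
  obtain ⟨l, hl_len, hl, hl_prod⟩ := exists_word_mid u
  obtain ⟨k, hk_len, hk, hk_prod⟩ := exists_word_mid (u⁻¹ * w)
  have hbal : IsBalanced u := by
    rw [← hl_prod]
    refine hw [] l k (fun x hx => ?_) (by simp [hl_prod, hk_prod]) (by simp; omega)
    rcases List.mem_append.1 hx with h | h
    exacts [hl x h, hk x h]
  obtain ⟨xs, rfl, hxs⟩ := hbal.exists_isBalancedPath hrs
    (by rw [hprod, inv_mul_cancel, wordLength_coxB_one, ← hlen, add_zero])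
  rw [← map_list_prod] at hprod
  have hxu : xs.prod = u := by
    have h1 := hxs.isBalanced_prod_inv_mul.wordLength_midToCoxB
    rw [map_mul, map_inv, hprod, inv_mul_cancel, wordLength_coxB_one] at h1
    obtain ⟨z, hz, -, hz_prod⟩ := exists_word_mid (xs.prod⁻¹ * u)
    rw [← h1, List.length_eq_zero_iff] at hz
    rw [hz, List.prod_nil] at hz_prod
    exact inv_mul_eq_one.1 hz_prod.symm
  have hxk : (xs ++ k).prod = w := by rw [List.prod_append, hxu, hk_prod, mul_inv_cancel_left]
  have hxk_mem : ∀ x ∈ xs ++ k, x ∈ midGens n := by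
    intro x hx
    rcases List.mem_append.1 hx with h | h
    exacts [hxs.mem_midGens x h, hk x h]
  have hxk_len : (xs ++ k).length = wordLength (midGens n) w := by
    rw [List.length_map, hbal.wordLength_midToCoxB] at hlen
    rw [List.length_append]
    omega
  refine ⟨xs, rfl, hxu, ?_⟩
  rw [← hxk]
  refine isBalancedPath_of_geodesic hxk_mem (fun s hs => ?_) (by rw [hxk_len, hxk])
  obtain ⟨p, hp⟩ := hs
  exact hw p s [] (by simpa [hp] using hxk_mem) (by simpa [hp] using hxk)
    (by simpa [hp] using hxk_len)

theorem wordLength_midToCoxB_of_mem (hw : HasBalancedFactors w)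
    (hu : wordLength (midGens n) u + wordLength (midGens n) (u⁻¹ * w) = wordLength (midGens n) w) :
    wordLength (coxBRefl n) (midToCoxB n u) = wordLength (midGens n) u ∧
      wordLength (coxBRefl n) ((midToCoxB n u)⁻¹ * midToCoxB n w) =
        wordLength (midGens n) (u⁻¹ * w) := by
  have h1 := wordLength_midToCoxB_le u
  have h2 := wordLength_midToCoxB_le (u⁻¹ * w)
  have h3 := wordLength_mul_le exists_word_coxB (midToCoxB n u)
    ((midToCoxB n u)⁻¹ * midToCoxB n w)
  rw [mul_inv_cancel_left, hw.isBalanced.wordLength_midToCoxB] at h3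
  rw [map_mul, map_inv] at h2
  omega

theorem bijOn (hw : HasBalancedFactors w) :
    Set.BijOn (midToCoxB n)
      {u : Mid n | wordLength (midGens n) u + wordLength (midGens n) (u⁻¹ * w) =
        wordLength (midGens n) w}
      {u : CoxB n | wordLength (coxBRefl n) u + wordLength (coxBRefl n) (u⁻¹ * midToCoxB n w) =
        wordLength (coxBRefl n) (midToCoxB n w)} := by
  refine ⟨fun u hu => ?_, fun u hu v hv huv => ?_, fun h hh => ?_⟩
  · rw [Set.mem_ofPred_eq] at hu ⊢
    obtain ⟨h1, h2⟩ := hw.wordLength_midToCoxB_of_mem hu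
    rw [h1, h2, hu, hw.isBalanced.wordLength_midToCoxB]
  · obtain ⟨rs, hlen, hrs, hprod⟩ := exists_word_coxB (midToCoxB n u)
    obtain ⟨xs, hxs, rfl, hpx⟩ := hw.exists_isBalancedPath hu hrs hprod hlen
    obtain ⟨ys, hys, rfl, hpy⟩ :=
      hw.exists_isBalancedPath hv hrs (hprod.trans huv) (hlen.trans (by rw [huv]))
    rw [hpx.eq_of_map_eq hpy (hxs.trans hys.symm)]
  · rw [Set.mem_ofPred_eq] at hh
    obtain ⟨rs, hlen, hrs, rfl⟩ := exists_word_coxB h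
    obtain ⟨xs, rfl, hpath⟩ := hw.isBalanced.exists_isBalancedPath hrs (by rw [hlen, hh])
    refine ⟨xs.prod, ?_, map_list_prod _ _⟩
    have h1 := hpath.isBalanced_prod_inv_mul.wordLength_midToCoxB
    have h2 := wordLength_le_length hpath.mem_midGens
    have h3 := wordLength_mul_le exists_word_mid xs.prod (xs.prod⁻¹ * w)
    rw [mul_inv_cancel_left] at h3
    rw [map_mul, map_inv, map_list_prod] at h1
    rw [hw.isBalanced.wordLength_midToCoxB, h1, ← hlen, List.length_map] at hh
    rw [Set.mem_ofPred_eq]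
    omega

theorem le_iff (hw : HasBalancedFactors w)
    (hu : wordLength (midGens n) u + wordLength (midGens n) (u⁻¹ * w) = wordLength (midGens n) w)
    (hv : wordLength (midGens n) v + wordLength (midGens n) (v⁻¹ * w) = wordLength (midGens n) w) :
    wordLength (midGens n) u + wordLength (midGens n) (u⁻¹ * v) +
        wordLength (midGens n) (v⁻¹ * w) = wordLength (midGens n) w ↔
      wordLength (coxBRefl n) (midToCoxB n u) +
        wordLength (coxBRefl n) ((midToCoxB n u)⁻¹ * midToCoxB n v) +
        wordLength (coxBRefl n) ((midToCoxB n v)⁻¹ * midToCoxB n w) =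
          wordLength (coxBRefl n) (midToCoxB n w) := by
  obtain ⟨hu1, hu2⟩ := hw.wordLength_midToCoxB_of_mem hu
  obtain ⟨hv1, hv2⟩ := hw.wordLength_midToCoxB_of_mem hv
  have hww := hw.isBalanced.wordLength_midToCoxB
  constructor
  · intro h
    have h1 := wordLength_midToCoxB_le (u⁻¹ * v)
    have h2 := wordLength_mul_le exists_word_coxB (midToCoxB n u)
      ((midToCoxB n u)⁻¹ * midToCoxB n v)
    rw [mul_inv_cancel_left] at h2
    rw [map_mul, map_inv] at h1
    omega
  · intro h
    obtain ⟨rs, hrs_len, hrs, hrs_prod⟩ := exists_word_coxB (midToCoxB n u)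
    obtain ⟨ss, hss_len, hss, hss_prod⟩ := exists_word_coxB ((midToCoxB n u)⁻¹ * midToCoxB n v)
    obtain ⟨xs, hxs, rfl, hpx⟩ := hw.exists_isBalancedPath hu hrs hrs_prod hrs_len
    have happ : ∀ r ∈ rs ++ ss, r ∈ coxBRefl n := by
      intro r hr
      rcases List.mem_append.1 hr with h | h
      exacts [hrs r h, hss r h]
    obtain ⟨ys, hys, rfl, hpy⟩ := hw.exists_isBalancedPath hv happ
      (by rw [List.prod_append, hrs_prod, hss_prod, mul_inv_cancel_left])
      (by rw [List.length_append]; omega)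
    obtain ⟨as, bs, rfl, has, hbs⟩ := List.map_eq_append_iff.1 hys
    obtain rfl := hpy.of_append.eq_of_map_eq hpx (has.trans hxs.symm)
    have h1 := wordLength_le_length (S := midGens n) (l := bs)
      fun x hx => hpy.mem_midGens x (by simp [hx])
    have h2 := wordLength_mul_le exists_word_mid as.prod (as.prod⁻¹ * (as ++ bs).prod)
    rw [mul_inv_cancel_left] at h2
    have h3 : as.prod⁻¹ * (as ++ bs).prod = bs.prod := by
      rw [List.prod_append, inv_mul_cancel_left]
    have h4 : bs.length = ss.length := by rw [← hbs, List.length_map]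
    rw [h3] at h2 ⊢
    omega

end HasBalancedFactors

theorem blockSum_univ_list_prod (l : List (Mid n)) :
    blockSum Finset.univ l.prod = (l.map (blockSum Finset.univ)).sum := by
  induction l with
  | nil => simp [blockSum]
  | cons x l ih =>
    rw [List.prod_cons, blockSum_mul (isInvBlock_univ _), ih, List.map_cons, List.sum_cons]

theorem inr_swap_eq_midRefl (i j : Fin n) :
    (SemidirectProduct.inr (Equiv.swap i j) : Mid n) = midRefl i j 0 :=
  mid_ext (fun l => by rw [midVec_midRefl, zero_mul]; rfl) rfl

end Mid

/-- The defining word of the special element. -/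
def midSpecialWord (m : ℕ) : List (Mid (m + 2)) :=
  midTrans 0 1 :: (List.finRange (m + 1)).map fun i => midRefl i.castSucc i.succ 0

theorem midSpecialWord_prod (m : ℕ) : (midSpecialWord m).prod = midSpecialElt m := by
  simp only [midSpecialWord, midSpecialElt, List.prod_cons, inr_swap_eq_midRefl]
  rfl

theorem mem_midGens_of_mem_midSpecialWord {m : ℕ} {x : Mid (m + 2)} (hx : x ∈ midSpecialWord m) :
    x ∈ midGens (m + 2) := by
  rw [mem_midGens_iff]
  rcases List.mem_cons.1 hx with rfl | hx
  · exact Or.inl ⟨0, Or.inl rfl⟩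
  · obtain ⟨i, -, rfl⟩ := List.mem_map.1 hx
    exact Or.inr ⟨_, _, 0, Fin.castSucc_lt_succ.ne, rfl⟩

theorem blockSum_univ_midSpecialElt (m : ℕ) : blockSum Finset.univ (midSpecialElt m) = 1 := by
  have h : (blockSum Finset.univ ∘ fun i : Fin (m + 1) => midRefl i.castSucc i.succ 0) =
      fun _ => 0 := by
    funext i
    rw [Function.comp_apply, blockSum_midRefl, zero_mul]
  rw [← midSpecialWord_prod, blockSum_univ_list_prod, midSpecialWord, List.map_cons, List.map_map,
    h, List.sum_cons, blockSum_midTrans]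
  simp

theorem midSpecialElt_right_apply (m : ℕ) (i : Fin (m + 1)) :
    (midSpecialElt m).right i.castSucc = i.succ := by
  have hright : (midSpecialElt m).right = (List.finRange (m + 2)).formPerm := by
    have hzip : List.zipWith Equiv.swap (List.finRange (m + 2)) (List.finRange (m + 2)).tail =
        (List.finRange (m + 1)).map fun i => Equiv.swap i.castSucc i.succ :=
      List.ext_getElem (by simp) fun k _ _ => by simp
    rw [List.formPerm, hzip, midSpecialElt, ← SemidirectProduct.rightHom_eq_right, map_mul,
      map_list_prod, List.map_map, SemidirectProduct.rightHom_inl, one_mul]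
    rfl
  have h := List.formPerm_apply_lt_getElem (List.finRange (m + 2)) (List.nodup_finRange _) i
    (by rw [List.length_finRange]; omega)
  simp only [List.getElem_finRange] at h
  rw [hright]
  exact h

theorem finrank_fixSpace_midSpecialElt_le (m : ℕ) :
    Module.finrank ℚ (fixSpace 1 (midSpecialElt m)) ≤ 1 := by
  refine finrank_le_one ⟨fun _ => 1, fun l => by simp⟩ fun f => ⟨f.1 0, ?_⟩
  refine Subtype.ext (funext fun l => ?_)
  change f.1 0 * 1 = f.1 l
  rw [mul_one]
  induction l using Fin.induction with
  | zero => rfl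
  | succ i ih =>
    have h := f.2 i.castSucc
    rw [midSpecialElt_right_apply, one_zpow, Units.val_one, one_mul] at h
    rw [h, ih]

theorem hasBalancedFactors_midSpecialElt (m : ℕ) : HasBalancedFactors (midSpecialElt m) := by
  intro l₁ l₂ l₃ hl hprod hlen
  refine isBalanced_of_factor (finrank_fixSpace_midSpecialElt_le m) (blockSum_univ_midSpecialElt m)
    hl hprod ?_
  rw [hlen, ← midSpecialWord_prod]
  refine (wordLength_le_length fun x => mem_midGens_of_mem_midSpecialWord).trans ?_
  simp [midSpecialWord]

/-- For `n = m + 2 ≥ 2`, the projection `Mid(B_n) → Cox(B_n)` restricts to a bijection from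
the interval `[1, w]` of the middle group (with its full generating set) onto the interval
`[1, π(w)]` of the type `B_n` Coxeter group (with its reflection generating set), and this
bijection is an isomorphism of partially ordered sets. -/
theorem mid_interval_iso_coxB_interval (m : ℕ) :
    Set.BijOn (midToCoxB (m + 2))
      {u : Mid (m + 2) |
        wordLength (midGens (m + 2)) u +
          wordLength (midGens (m + 2)) (u⁻¹ * midSpecialElt m) =
          wordLength (midGens (m + 2)) (midSpecialElt m)}
      {u : CoxB (m + 2) |
        wordLength (coxBRefl (m + 2)) u +
          wordLength (coxBRefl (m + 2)) (u⁻¹ * midToCoxB (m + 2) (midSpecialElt m)) =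
          wordLength (coxBRefl (m + 2)) (midToCoxB (m + 2) (midSpecialElt m))} ∧
    ∀ u v : Mid (m + 2),
      wordLength (midGens (m + 2)) u +
          wordLength (midGens (m + 2)) (u⁻¹ * midSpecialElt m) =
          wordLength (midGens (m + 2)) (midSpecialElt m) →
      wordLength (midGens (m + 2)) v +
          wordLength (midGens (m + 2)) (v⁻¹ * midSpecialElt m) =
          wordLength (midGens (m + 2)) (midSpecialElt m) →
      (wordLength (midGens (m + 2)) u + wordLength (midGens (m + 2)) (u⁻¹ * v) +
          wordLength (midGens (m + 2)) (v⁻¹ * midSpecialElt m) =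
          wordLength (midGens (m + 2)) (midSpecialElt m) ↔
        wordLength (coxBRefl (m + 2)) (midToCoxB (m + 2) u) +
          wordLength (coxBRefl (m + 2)) ((midToCoxB (m + 2) u)⁻¹ * midToCoxB (m + 2) v) +
          wordLength (coxBRefl (m + 2)) ((midToCoxB (m + 2) v)⁻¹ *
            midToCoxB (m + 2) (midSpecialElt m)) =
          wordLength (coxBRefl (m + 2)) (midToCoxB (m + 2) (midSpecialElt m))) := by
  exact ⟨(hasBalancedFactors_midSpecialElt m).bijOn, fun _ _ hu hv =>
    (hasBalancedFactors_midSpecialElt m).le_iff hu hv⟩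
end

section
/- For n ≥ 2, the presented group with generators t, s_1, …, s_{n−1} and relations s_i² = 1 for all i, s_i s_j = s_j s_i whenever |i − j| ≥ 2, s_i s_{i+1} s_i = s_{i+1} s_i s_{i+1} for 1 ≤ i ≤ n−2, t s_i = s_i t for all i ≥ 2, and t s_1 t s_1 = s_1 t s_1 t, is isomorphic to the middle group Mid(B_n) = (Fin n → ℤ) ⋊ Equiv.Perm (Fin n) via the map sending t to (e_1, 1) and s_i to (0, swap i (i+1)). -/
open Multiplicative

/-- Generators for the presentation of the middle group `Mid(B_n)` with `n = m + 2`: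
`none` is the translation generator `t` and `some i` is the transposition `s_{i+1}`
(so `i : Fin (m+1)` ranges over the `n − 1` adjacent transpositions). -/
abbrev MidGen (m : ℕ) := Option (Fin (m + 1))

/-- The relations of the middle group presentation: the `s_i` are involutions which braid
when adjacent and commute otherwise, `t` commutes with `s_i` for `i ≥ 2`, and
`t s_1 t s_1 = s_1 t s_1 t`. -/
def midPresRels (m : ℕ) : Set (FreeGroup (MidGen m)) :=
  {w | (∃ i : Fin (m + 1), w = (FreeGroup.of (some i)) ^ 2) ∨
       (∃ i j : Fin (m + 1), ((i : ℕ) + 2 ≤ (j : ℕ) ∨ (j : ℕ) + 2 ≤ (i : ℕ)) ∧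
          w = FreeGroup.of (some i) * FreeGroup.of (some j) *
              (FreeGroup.of (some j) * FreeGroup.of (some i))⁻¹) ∨
       (∃ i j : Fin (m + 1), (j : ℕ) = (i : ℕ) + 1 ∧
          w = FreeGroup.of (some i) * FreeGroup.of (some j) * FreeGroup.of (some i) *
              (FreeGroup.of (some j) * FreeGroup.of (some i) * FreeGroup.of (some j))⁻¹) ∨
       (∃ i : Fin (m + 1), 1 ≤ (i : ℕ) ∧
          w = FreeGroup.of none * FreeGroup.of (some i) *
              (FreeGroup.of (some i) * FreeGroup.of none)⁻¹) ∨
       (w = FreeGroup.of none * FreeGroup.of (some 0) * FreeGroup.of none *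
              FreeGroup.of (some 0) *
            (FreeGroup.of (some 0) * FreeGroup.of none * FreeGroup.of (some 0) *
              FreeGroup.of none)⁻¹)}

/-- A family `s 0, …, s (N - 1)` satisfying the Coxeter relations of type `A_N`. -/
structure IsBraidedInvolutions {G : Type*} [Group G] (N : ℕ) (s : ℕ → G) : Prop where
  sq : ∀ i, i < N → s i * s i = 1
  comm : ∀ i j, j < N → i + 2 ≤ j → Commute (s i) (s j)
  braid : ∀ i, i + 1 < N → s i * s (i + 1) * s i = s (i + 1) * s i * s (i + 1)

/-- The product `s j * s (j + 1) * ⋯ * s (j + d - 1)`. -/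
def consecutiveProd {G : Type*} [Group G] (s : ℕ → G) (j d : ℕ) : G :=
  ((List.range' j d).map s).prod

section Coxeter

variable {G : Type*} [Group G] {N : ℕ} {s : ℕ → G}

theorem consecutiveProd_zero (j : ℕ) : consecutiveProd s j 0 = 1 := by
  simp [consecutiveProd]

theorem consecutiveProd_succ (j d : ℕ) :
    consecutiveProd s j (d + 1) = s j * consecutiveProd s (j + 1) d := by
  simp [consecutiveProd, List.range'_succ]

theorem IsBraidedInvolutions.commute_consecutiveProd (hs : IsBraidedInvolutions N s) {i j d : ℕ}
    (hij : i + 2 ≤ j) (hd : j + d ≤ N) : Commute (s i) (consecutiveProd s j d) := by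
  induction d generalizing j with
  | zero => rw [consecutiveProd_zero]; exact Commute.one_right _
  | succ d ih =>
    rw [consecutiveProd_succ]
    exact (hs.comm i j (by omega) hij).mul_right (ih (by omega) (by omega))

theorem IsBraidedInvolutions.mul_consecutiveProd (hs : IsBraidedInvolutions N s) {i j d : ℕ}
    (hji : j ≤ i) (hid : i + 1 < j + d) (hd : j + d ≤ N) :
    s (i + 1) * consecutiveProd s j d = consecutiveProd s j d * s i := by
  induction d generalizing j with
  | zero => omega
  | succ d ih =>
    rw [consecutiveProd_succ]
    rcases hji.eq_or_lt with rfl | hlt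
    · obtain ⟨e, rfl⟩ : ∃ e, d = e + 1 := ⟨d - 1, by omega⟩
      have hc := (hs.commute_consecutiveProd (i := j) (j := j + 2) (d := e) le_rfl (by omega)).eq
      rw [consecutiveProd_succ, ← mul_assoc, ← mul_assoc, ← hs.braid j (by omega)]
      simp only [mul_assoc]
      rw [hc]
    · rw [← mul_assoc, ← (hs.comm j (i + 1) (by omega) (by omega)).eq, mul_assoc,
        ih (by omega) (by omega) (by omega), mul_assoc]

theorem IsBraidedInvolutions.exists_eq_consecutiveProd_mul (hs : IsBraidedInvolutions N s)
    {k : ℕ} (hk : k < N) {g : G} (hg : g ∈ Subgroup.closure (s '' Set.Iio (k + 1))) :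
    ∃ j d, j + d = k + 1 ∧ ∃ h ∈ Subgroup.closure (s '' Set.Iio k),
      g = consecutiveProd s j d * h := by
  have step : ∀ i, i < k + 1 → ∀ y : G,
      (∃ j d, j + d = k + 1 ∧ ∃ h ∈ Subgroup.closure (s '' Set.Iio k),
        y = consecutiveProd s j d * h) →
      ∃ j d, j + d = k + 1 ∧ ∃ h ∈ Subgroup.closure (s '' Set.Iio k),
        s i * y = consecutiveProd s j d * h := by
    rintro i hi _ ⟨j, d, hjd, h, hh, rfl⟩
    have hmem : ∀ l, l < k → s l * h ∈ Subgroup.closure (s '' Set.Iio k) := fun l hl =>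
      mul_mem (Subgroup.subset_closure ⟨l, hl, rfl⟩) hh
    rcases lt_trichotomy i j with hij | rfl | hij
    · rcases (Nat.succ_le_of_lt hij).eq_or_lt with rfl | hlt
      · exact ⟨i, d + 1, by omega, h, hh, by rw [consecutiveProd_succ, mul_assoc]⟩
      · refine ⟨j, d, hjd, s i * h, hmem i (by omega), ?_⟩
        rw [← mul_assoc, (hs.commute_consecutiveProd hlt (by omega)).eq, mul_assoc]
    · obtain ⟨e, rfl⟩ : ∃ e, d = e + 1 := ⟨d - 1, by omega⟩
      refine ⟨i + 1, e, by omega, h, hh, ?_⟩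
      rw [consecutiveProd_succ, ← mul_assoc, ← mul_assoc, hs.sq i (by omega), one_mul]
    · obtain ⟨l, rfl⟩ : ∃ l, i = l + 1 := ⟨i - 1, by omega⟩
      refine ⟨j, d, hjd, s l * h, hmem l (by omega), ?_⟩
      rw [← mul_assoc, hs.mul_consecutiveProd (by omega) (by omega) (by omega), mul_assoc]
  induction hg using Subgroup.closure_induction_left with
  | one => exact ⟨k + 1, 0, by omega, 1, one_mem _, by simp [consecutiveProd_zero]⟩
  | mul_left x hx y _ ih =>
    obtain ⟨i, hi, rfl⟩ := hx
    exact step i hi y ih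
  | inv_mul_cancel x hx y _ ih =>
    obtain ⟨i, hi, rfl⟩ := hx
    rw [Set.mem_Iio] at hi
    rw [inv_eq_of_mul_eq_one_left (hs.sq i (by omega))]
    exact step i hi y ih

/-- A permutation representation in which `s i` moves `p (i + 1)` to `p i` and fixes the later
points is faithful on the group generated by a family satisfying the Coxeter relations. -/
theorem IsBraidedInvolutions.eq_one_of_map_eq_one (hs : IsBraidedInvolutions N s) {α : Type*}
    (f : G →* Equiv.Perm α) (p : ℕ → α) (hp : Set.InjOn p (Set.Iic N))
    (hmove : ∀ i, i < N → f (s i) (p (i + 1)) = p i)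
    (hfix : ∀ i j, i + 1 < j → j ≤ N → f (s i) (p j) = p j)
    {g : G} (hg : g ∈ Subgroup.closure (s '' Set.Iio N)) (hfg : f g = 1) : g = 1 := by
  have hcons : ∀ d j, j + d ≤ N → f (consecutiveProd s j d) (p (j + d)) = p j := by
    intro d
    induction d with
    | zero => intro j _; simp [consecutiveProd_zero]
    | succ d ih =>
      intro j hj
      rw [consecutiveProd_succ, map_mul, Equiv.Perm.mul_apply,
        show j + (d + 1) = j + 1 + d by omega, ih (j + 1) (by omega), hmove j (by omega)]
  have hstab : ∀ k, k < N → ∀ h ∈ Subgroup.closure (s '' Set.Iio k),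
      f h (p (k + 1)) = p (k + 1) := by
    intro k hk h hh
    induction hh using Subgroup.closure_induction with
    | mem x hx =>
      obtain ⟨i, hi, rfl⟩ := hx
      rw [Set.mem_Iio] at hi
      exact hfix i (k + 1) (by omega) (by omega)
    | one => simp
    | mul x y _ _ hx hy => rw [map_mul, Equiv.Perm.mul_apply, hy, hx]
    | inv x _ hx => rw [map_inv, Equiv.Perm.inv_eq_iff_eq, hx]
  have hdescend : ∀ k, k ≤ N → g ∈ Subgroup.closure (s '' Set.Iio k) → g = 1 := by
    intro k
    induction k with
    | zero => intro _ hg; simpa using hg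
    | succ k ih =>
      intro hk hg
      obtain ⟨j, d, hjd, h, hh, rfl⟩ := hs.exists_eq_consecutiveProd_mul (by omega) hg
      have hpt : p j = p (k + 1) := by
        rw [← hcons d j (by omega), hjd]
        conv_lhs => rw [← hstab k (by omega) h hh]
        rw [← Equiv.Perm.mul_apply, ← map_mul, hfg, Equiv.Perm.one_apply]
      have hj : j = k + 1 := hp (Set.mem_Iic.2 (by omega)) (Set.mem_Iic.2 hk) hpt
      obtain rfl : d = 0 := by omega
      refine ih (by omega) ?_
      rwa [consecutiveProd_zero, one_mul]
  exact hdescend N le_rfl hg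

end Coxeter

/-- The conjugates `t, s 0 * t * (s 0)⁻¹, …` of `t` under successive prefixes of `s`. -/
def prefixConj {G : Type*} [Group G] (s : ℕ → G) (t : G) : ℕ → G
  | 0 => t
  | i + 1 => s i * prefixConj s t i * (s i)⁻¹

section PrefixConj

variable {G : Type*} [Group G] {N : ℕ} {s : ℕ → G} {t : G}

theorem mul_prefixConj (s : ℕ → G) (t : G) (i : ℕ) :
    s i * prefixConj s t i = prefixConj s t (i + 1) * s i := by
  simp [prefixConj]

theorem IsBraidedInvolutions.mul_prefixConj_succ (hs : IsBraidedInvolutions N s) {i : ℕ}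
    (hi : i < N) : s i * prefixConj s t (i + 1) = prefixConj s t i * s i := by
  have h := inv_eq_of_mul_eq_one_left (hs.sq i hi)
  rw [prefixConj, h, ← mul_assoc, ← mul_assoc, hs.sq i hi, one_mul]

theorem IsBraidedInvolutions.commute_prefixConj_of_lt (hs : IsBraidedInvolutions N s)
    (ht : ∀ i, 1 ≤ i → i < N → Commute t (s i)) {i j : ℕ} (hji : j < i) (hi : i < N) :
    Commute (s i) (prefixConj s t j) := by
  induction j with
  | zero => exact (ht i hji hi).symm
  | succ j ih =>
    have hc := (hs.comm j i hi (by omega)).symm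
    exact (hc.mul_right (ih (by omega))).mul_right hc.inv_right

theorem IsBraidedInvolutions.commute_prefixConj_of_succ_lt (hs : IsBraidedInvolutions N s)
    (ht : ∀ i, 1 ≤ i → i < N → Commute t (s i)) {i j : ℕ} (hij : i + 1 < j) (hj : j ≤ N) :
    Commute (s i) (prefixConj s t j) := by
  induction j, hij using Nat.le_induction with
  | base =>
    have hb := hs.braid i (by omega)
    have hc : s (i + 1) * prefixConj s t i * (s (i + 1))⁻¹ = prefixConj s t i := by
      rw [(hs.commute_prefixConj_of_lt ht (Nat.lt_succ_self i) (by omega)).eq,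
        mul_inv_cancel_right]
    have key : s i * prefixConj s t (i + 2) * (s i)⁻¹ = prefixConj s t (i + 2) := by
      calc s i * prefixConj s t (i + 2) * (s i)⁻¹
          = (s i * s (i + 1) * s i) * prefixConj s t i * (s i * s (i + 1) * s i)⁻¹ := by
            simp only [prefixConj, mul_inv_rev, mul_assoc]
        _ = s (i + 1) * (s i * (s (i + 1) * prefixConj s t i * (s (i + 1))⁻¹) * (s i)⁻¹) *
              (s (i + 1))⁻¹ := by
            rw [hb]; simp only [mul_inv_rev, mul_assoc]
        _ = prefixConj s t (i + 2) := by rw [hc]; rfl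
    exact mul_inv_eq_iff_eq_mul.1 key
  | succ j hij ih =>
    have hc := hs.comm i j (by omega) (by omega)
    exact (hc.mul_right (ih (by omega))).mul_right hc.inv_right

theorem IsBraidedInvolutions.commute_prefixConj (hs : IsBraidedInvolutions N s)
    (ht : ∀ i, 1 ≤ i → i < N → Commute t (s i))
    (htt : t * s 0 * t * s 0 = s 0 * t * s 0 * t) {i j : ℕ} (hij : i < j) (hj : j ≤ N) :
    Commute (prefixConj s t i) (prefixConj s t j) := by
  induction i with
  | zero =>
    induction j, hij using Nat.le_induction with
    | base =>
      have h := inv_eq_of_mul_eq_one_left (hs.sq 0 (by omega))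
      simp only [prefixConj, Commute, SemiconjBy, h, ← mul_assoc]
      exact htt
    | succ j hj' ih =>
      have hc := ht j (by omega) (by omega)
      exact (hc.mul_right (ih (by omega))).mul_right hc.inv_right
  | succ i ih =>
    have hc := hs.commute_prefixConj_of_succ_lt ht hij hj
    exact (hc.mul_left (ih (by omega))).mul_left hc.inv_left

theorem IsBraidedInvolutions.exists_mul_prefixConj (hs : IsBraidedInvolutions N s)
    (ht : ∀ i, 1 ≤ i → i < N → Commute t (s i)) {i j : ℕ} (hi : i < N) (hj : j ≤ N) :
    ∃ l ≤ N, s i * prefixConj s t j = prefixConj s t l * s i := by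
  rcases lt_trichotomy j i with h | rfl | h
  · exact ⟨j, hj, (hs.commute_prefixConj_of_lt ht h hi).eq⟩
  · exact ⟨j + 1, hi, mul_prefixConj s t j⟩
  · rcases (Nat.succ_le_of_lt h).eq_or_lt with rfl | h
    · exact ⟨i, hi.le, hs.mul_prefixConj_succ hi⟩
    · exact ⟨j, hj, (hs.commute_prefixConj_of_succ_lt ht h hj).eq⟩

/-- Every element of the group generated by `t` and `s` is a product of a translation and an
element of the group generated by `s`. -/
theorem IsBraidedInvolutions.exists_eq_mul (hs : IsBraidedInvolutions N s)
    (ht : ∀ i, 1 ≤ i → i < N → Commute t (s i)) {g : G}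
    (hg : g ∈ Subgroup.closure (insert t (s '' Set.Iio N))) :
    ∃ a ∈ Subgroup.closure (prefixConj s t '' Set.Iic N),
      ∃ w ∈ Subgroup.closure (s '' Set.Iio N), g = a * w := by
  have ht_mem : t ∈ Subgroup.closure (prefixConj s t '' Set.Iic N) :=
    Subgroup.subset_closure ⟨0, Nat.zero_le N, rfl⟩
  have hconj : ∀ i, i < N → ∀ a ∈ Subgroup.closure (prefixConj s t '' Set.Iic N),
      s i * a * (s i)⁻¹ ∈ Subgroup.closure (prefixConj s t '' Set.Iic N) := by
    intro i hi
    suffices h : Subgroup.closure (prefixConj s t '' Set.Iic N) ≤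
        (Subgroup.closure (prefixConj s t '' Set.Iic N)).comap (MulAut.conj (s i)).toMonoidHom from
      fun a ha => h ha
    rw [Subgroup.closure_le]
    rintro _ ⟨j, hj, rfl⟩
    obtain ⟨l, hl, h⟩ := hs.exists_mul_prefixConj ht hi hj
    refine Subgroup.subset_closure ⟨l, hl, ?_⟩
    simp [h]
  have step : ∀ i, i < N → ∀ y : G,
      (∃ a ∈ Subgroup.closure (prefixConj s t '' Set.Iic N),
        ∃ w ∈ Subgroup.closure (s '' Set.Iio N), y = a * w) →
      ∃ a ∈ Subgroup.closure (prefixConj s t '' Set.Iic N),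
        ∃ w ∈ Subgroup.closure (s '' Set.Iio N), s i * y = a * w := by
    rintro i hi _ ⟨a, ha, w, hw, rfl⟩
    exact ⟨_, hconj i hi a ha, s i * w, mul_mem (Subgroup.subset_closure ⟨i, hi, rfl⟩) hw,
      by group⟩
  induction hg using Subgroup.closure_induction_left with
  | one => exact ⟨1, one_mem _, 1, one_mem _, by simp⟩
  | mul_left x hx y _ ih =>
    rcases hx with rfl | ⟨i, hi, rfl⟩
    · obtain ⟨a, ha, w, hw, rfl⟩ := ih
      exact ⟨x * a, mul_mem ht_mem ha, w, hw, by rw [mul_assoc]⟩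
    · exact step i hi y ih
  | inv_mul_cancel x hx y _ ih =>
    rcases hx with rfl | ⟨i, hi, rfl⟩
    · obtain ⟨a, ha, w, hw, rfl⟩ := ih
      exact ⟨x⁻¹ * a, mul_mem (inv_mem ht_mem) ha, w, hw, by rw [mul_assoc]⟩
    · rw [inv_eq_of_mul_eq_one_left (hs.sq i hi)]
      exact step i hi y ih

end PrefixConj

/-- A homomorphism sending commuting elements `x i` to the standard basis vectors of an embedded
`ι → ℤ` maps the subgroup they generate into this copy of `ι → ℤ`, with trivial kernel. -/
theorem mem_range_and_eq_one_of_map_basis {G ι : Type*} [Group G] [Fintype ι] [DecidableEq ι]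
    (x : ι → G)
    (hx : Pairwise fun i j => Commute (x i) (x j)) {H : Type*} [Group H] (φ : G →* H)
    (e : Multiplicative (ι → ℤ) →* H) (he : Function.Injective e)
    (hφ : ∀ i, φ (x i) = e (ofAdd (Pi.single i 1))) {g : G}
    (hg : g ∈ Subgroup.closure (Set.range x)) : (∃ v, φ g = e v) ∧ (φ g = 1 → g = 1) := by
  have hcomm : Pairwise fun i j => ∀ a b : Multiplicative ℤ,
      Commute (zpowersHom G (x i) a) (zpowersHom G (x j) b) := fun i j hij a b => by
    simpa only [zpowersHom_apply] using (hx hij).zpow_zpow _ _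
  let F : (ι → Multiplicative ℤ) →* G :=
    MonoidHom.noncommPiCoprod (fun i => zpowersHom G (x i)) hcomm
  let E : (ι → Multiplicative ℤ) →* H :=
    e.comp (MonoidHom.mk' (fun v => ofAdd fun i => toAdd (v i)) fun _ _ => rfl)
  have hF : φ.comp F = E := by
    refine MonoidHom.pi_ext fun i y => ?_
    suffices h : (φ.comp F).comp (MonoidHom.mulSingle _ i) = E.comp (MonoidHom.mulSingle _ i) from
      DFunLike.congr_fun h y
    refine MonoidHom.ext_mint ?_
    have h1 : F (Pi.mulSingle i (ofAdd 1)) = x i := by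
      simp [F, MonoidHom.noncommPiCoprod_mulSingle]
    have h2 : E (Pi.mulSingle i (ofAdd 1)) = e (ofAdd (Pi.single i 1)) := by
      rfl
    simp only [MonoidHom.comp_apply, MonoidHom.mulSingle_apply]
    rw [h1, h2, hφ]
  have hmem : g ∈ F.range := by
    refine (Subgroup.closure_le _).2 ?_ hg
    rintro _ ⟨i, rfl⟩
    exact ⟨Pi.mulSingle i (ofAdd 1), by simp [F, MonoidHom.noncommPiCoprod_mulSingle]⟩
  obtain ⟨v, rfl⟩ := hmem
  have hv : φ (F v) = E v := DFunLike.congr_fun hF v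
  refine ⟨⟨_, hv⟩, fun h => ?_⟩
  rw [hv] at h
  have hv1 : (ofAdd fun i => toAdd (v i)) = (1 : Multiplicative (ι → ℤ)) :=
    he (h.trans (map_one e).symm)
  have : v = 1 := funext fun i => congrFun (congrArg toAdd hv1) i
  rw [this, map_one]

theorem inr_mul_inl_single {n : ℕ} (σ : Equiv.Perm (Fin n)) (i : Fin n) :
    (SemidirectProduct.inr σ * SemidirectProduct.inl (ofAdd (Pi.single i 1)) : Mid n) =
      SemidirectProduct.inl (ofAdd (Pi.single (σ i) 1)) * SemidirectProduct.inr σ := by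
  have h : permAction n ℤ σ (ofAdd (Pi.single i 1)) = ofAdd (Pi.single (σ i) 1) := by
    refine Multiplicative.toAdd.injective (funext fun j => ?_)
    simp [permAction, permMulAut, Pi.single_apply, Equiv.symm_apply_eq]
  rw [← h, SemidirectProduct.inl_aut, mul_assoc, ← map_mul, inv_mul_cancel, map_one, mul_one]

/-- The images of the generators of the presentation in `Mid (m + 2)`. -/
def midGenImage (m : ℕ) : MidGen m → Mid (m + 2)
  | none => SemidirectProduct.inl (ofAdd (Pi.single (0 : Fin (m + 2)) (1 : ℤ)))
  | some i => SemidirectProduct.inr (Equiv.swap i.castSucc i.succ)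

theorem lift_midGenImage_eq_one (m : ℕ) :
    ∀ r ∈ midPresRels m, FreeGroup.lift (midGenImage m) r = 1 := by
  rintro _ (⟨i, rfl⟩ | ⟨i, j, hij, rfl⟩ | ⟨i, j, hij, rfl⟩ | ⟨i, hi, rfl⟩ | rfl)
  · rw [map_pow, FreeGroup.lift_apply_of, midGenImage, ← map_pow, pow_two, Equiv.swap_mul_self,
      map_one]
  · simp only [map_mul, map_inv, FreeGroup.lift_apply_of, mul_inv_eq_one, midGenImage]
    rw [← map_mul, ← map_mul]
    congr 1
    ext x
    simp only [Equiv.Perm.mul_apply, Equiv.swap_apply_def, Fin.ext_iff]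
    grind
  · simp only [map_mul, map_inv, FreeGroup.lift_apply_of, mul_inv_eq_one, midGenImage]
    rw [← map_mul, ← map_mul, ← map_mul, ← map_mul]
    congr 1
    ext x
    simp only [Equiv.Perm.mul_apply, Equiv.swap_apply_def, Fin.ext_iff]
    grind
  · simp only [map_mul, map_inv, FreeGroup.lift_apply_of, mul_inv_eq_one, midGenImage]
    rw [inr_mul_inl_single, Equiv.swap_apply_of_ne_of_ne]
    · rw [Ne, Fin.ext_iff, Fin.val_castSucc, Fin.val_zero]; omega
    · rw [Ne, Fin.ext_iff, Fin.val_succ, Fin.val_zero]; omega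
  · simp only [map_mul, map_inv, FreeGroup.lift_apply_of, mul_inv_eq_one, midGenImage]
    have h := inr_mul_inl_single (Equiv.swap (0 : Fin (m + 1)).castSucc (0 : Fin (m + 1)).succ)
    have h0 := h (0 : Fin (m + 1)).castSucc
    have h1 := h (0 : Fin (m + 1)).succ
    rw [Equiv.swap_apply_left] at h0
    rw [Equiv.swap_apply_right] at h1
    rw [← Fin.castSucc_zero, h0]
    simp only [mul_assoc]
    rw [← mul_assoc (SemidirectProduct.inr _) (SemidirectProduct.inl _), h0,
      ← mul_assoc (SemidirectProduct.inr _) (SemidirectProduct.inl _), h1]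
    simp only [← mul_assoc]
    rw [← map_mul SemidirectProduct.inl, ← map_mul SemidirectProduct.inl, mul_comm]

/-- The homomorphism from the presented group to `Mid (m + 2)`. -/
def midPresHom (m : ℕ) : PresentedGroup (midPresRels m) →* Mid (m + 2) :=
  PresentedGroup.toGroup (lift_midGenImage_eq_one m)

theorem midPresHom_of (m : ℕ) (x : MidGen m) :
    midPresHom m (PresentedGroup.of x) = midGenImage m x :=
  PresentedGroup.toGroup.of _

/-- The generators `s_i` of the presented group, indexed by `ℕ` with junk value `1`. -/
def midPresS (m i : ℕ) : PresentedGroup (midPresRels m) :=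
  if h : i < m + 1 then PresentedGroup.of (some ⟨i, h⟩) else 1

theorem midPresS_of_lt {m i : ℕ} (h : i < m + 1) :
    midPresS m i = PresentedGroup.of (some ⟨i, h⟩) := dif_pos h

theorem isBraidedInvolutions_midPresS (m : ℕ) : IsBraidedInvolutions (m + 1) (midPresS m) where
  sq i hi := by
    have h := PresentedGroup.one_of_mem (rels := midPresRels m) (Or.inl ⟨⟨i, hi⟩, rfl⟩)
    rw [midPresS_of_lt hi, ← pow_two]
    exact h
  comm i j hj hij := by
    rw [midPresS_of_lt hj, midPresS_of_lt (by omega : i < m + 1)]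
    exact PresentedGroup.mk_eq_mk_of_mul_inv_mem (rels := midPresRels m)
      (Or.inr (Or.inl ⟨⟨i, by omega⟩, ⟨j, hj⟩, Or.inl hij, rfl⟩))
  braid i hi := by
    rw [midPresS_of_lt hi, midPresS_of_lt (by omega : i < m + 1)]
    exact PresentedGroup.mk_eq_mk_of_mul_inv_mem (rels := midPresRels m)
      (Or.inr (Or.inr (Or.inl ⟨⟨i, by omega⟩, ⟨i + 1, hi⟩, rfl, rfl⟩)))

theorem commute_of_none_midPresS (m i : ℕ) (h1 : 1 ≤ i) (hi : i < m + 1) :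
    Commute (PresentedGroup.of (rels := midPresRels m) none) (midPresS m i) := by
  rw [midPresS_of_lt hi]
  exact PresentedGroup.mk_eq_mk_of_mul_inv_mem (rels := midPresRels m)
    (Or.inr (Or.inr (Or.inr (Or.inl ⟨⟨i, hi⟩, h1, rfl⟩))))

theorem of_none_mul_midPresS_zero (m : ℕ) :
    PresentedGroup.of (rels := midPresRels m) none * midPresS m 0 * PresentedGroup.of none *
        midPresS m 0 =
      midPresS m 0 * PresentedGroup.of none * midPresS m 0 * PresentedGroup.of none := by
  rw [midPresS_of_lt (Nat.succ_pos m)]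
  exact PresentedGroup.mk_eq_mk_of_mul_inv_mem (rels := midPresRels m)
    (Or.inr (Or.inr (Or.inr (Or.inr rfl))))

theorem closure_insert_of_none_midPresS (m : ℕ) :
    Subgroup.closure (insert (PresentedGroup.of none) (midPresS m '' Set.Iio (m + 1))) = ⊤ := by
  rw [eq_top_iff, ← PresentedGroup.closure_range_of, Subgroup.closure_le]
  rintro _ ⟨x | i, rfl⟩
  · exact Subgroup.subset_closure (Set.mem_insert _ _)
  · exact Subgroup.subset_closure
      (Set.mem_insert_of_mem _ ⟨i, i.isLt, midPresS_of_lt i.isLt⟩)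

theorem midPresHom_midPresS {m i : ℕ} (hi : i < m + 1) :
    midPresHom m (midPresS m i) =
      SemidirectProduct.inr (Equiv.swap ⟨i, by omega⟩ ⟨i + 1, by omega⟩) := by
  rw [midPresS_of_lt hi, midPresHom_of]
  rfl

theorem midPresHom_prefixConj {m : ℕ} (i : ℕ) (hi : i < m + 2) :
    midPresHom m (prefixConj (midPresS m) (PresentedGroup.of none) i) =
      SemidirectProduct.inl (ofAdd (Pi.single ⟨i, hi⟩ 1)) := by
  induction i with
  | zero => exact midPresHom_of m none
  | succ i ih =>
    rw [prefixConj, map_mul, map_mul, map_inv, ih (by omega), midPresHom_midPresS (by omega),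
      inr_mul_inl_single, mul_inv_cancel_right, Equiv.swap_apply_left]

theorem midPresHom_injective (m : ℕ) : Function.Injective (midPresHom m) := by
  rw [injective_iff_map_eq_one]
  intro g hg
  have hs := isBraidedInvolutions_midPresS m
  have ht := commute_of_none_midPresS m
  obtain ⟨a, ha, w, hw, rfl⟩ := hs.exists_eq_mul ht (g := g)
    (by rw [closure_insert_of_none_midPresS]; trivial)
  have hrange : prefixConj (midPresS m) (PresentedGroup.of none) '' Set.Iic (m + 1) =
      Set.range fun i : Fin (m + 2) => prefixConj (midPresS m) (PresentedGroup.of none) i := by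
    ext x
    constructor
    · rintro ⟨i, hi, rfl⟩
      exact ⟨⟨i, Nat.lt_succ_of_le hi⟩, rfl⟩
    · rintro ⟨i, rfl⟩
      exact ⟨i, Nat.le_of_lt_succ i.isLt, rfl⟩
  rw [hrange] at ha
  have hcomm : Pairwise fun i j : Fin (m + 2) =>
      Commute (prefixConj (midPresS m) (PresentedGroup.of none) i)
        (prefixConj (midPresS m) (PresentedGroup.of none) j) := by
    intro i j hij
    have htt := of_none_mul_midPresS_zero m
    rcases lt_or_gt_of_ne hij with h | h
    · exact hs.commute_prefixConj ht htt h (Nat.le_of_lt_succ j.isLt)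
    · exact (hs.commute_prefixConj ht htt h (Nat.le_of_lt_succ i.isLt)).symm
  obtain ⟨⟨v, hv⟩, ha1⟩ :=
    mem_range_and_eq_one_of_map_basis _ hcomm (midPresHom m) SemidirectProduct.inl
      SemidirectProduct.inl_injective (fun i => midPresHom_prefixConj i i.isLt) ha
  have hw1 : w = 1 := by
    refine hs.eq_one_of_map_eq_one (SemidirectProduct.rightHom.comp (midPresHom m))
      (fun i => Fin.ofNat (m + 2) i) ?_ ?_ ?_ hw ?_
    · intro i hi j hj hij
      simpa [Fin.ext_iff, Nat.mod_eq_of_lt (Nat.lt_succ_of_le hi),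
        Nat.mod_eq_of_lt (Nat.lt_succ_of_le hj)] using hij
    · intro i hi
      have h1 : Fin.ofNat (m + 2) i = ⟨i, by omega⟩ := Fin.ext (Nat.mod_eq_of_lt (by omega))
      have h2 : Fin.ofNat (m + 2) (i + 1) = ⟨i + 1, by omega⟩ :=
        Fin.ext (Nat.mod_eq_of_lt (by omega))
      simp only [MonoidHom.comp_apply, midPresHom_midPresS hi, SemidirectProduct.rightHom_inr,
        h1, h2, Equiv.swap_apply_right]
    · intro i j hij hj
      have h2 : Fin.ofNat (m + 2) j = ⟨j, by omega⟩ := Fin.ext (Nat.mod_eq_of_lt (by omega))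
      simp only [MonoidHom.comp_apply, midPresHom_midPresS (by omega : i < m + 1),
        SemidirectProduct.rightHom_inr, h2]
      exact Equiv.swap_apply_of_ne_of_ne (by simp; omega) (by simp; omega)
    · have h := congrArg SemidirectProduct.rightHom hg
      simpa [hv] using h
  rw [hw1, mul_one] at hg ⊢
  exact ha1 hg

theorem midPresHom_surjective (m : ℕ) : Function.Surjective (midPresHom m) := by
  rw [← MonoidHom.range_eq_top, eq_top_iff]
  have hinr : ∀ σ, SemidirectProduct.inr σ ∈ (midPresHom m).range := by
    intro σ
    have h : (⊤ : Submonoid (Equiv.Perm (Fin (m + 2)))) ≤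
        (midPresHom m).range.toSubmonoid.comap SemidirectProduct.inr := by
      rw [← Equiv.Perm.mclosure_swap_castSucc_succ, Submonoid.closure_le]
      rintro _ ⟨i, rfl⟩
      exact ⟨_, midPresHom_of m (some i)⟩
    exact h (Submonoid.mem_top σ)
  have hbasis : ∀ i, SemidirectProduct.inl (ofAdd (Pi.single i 1)) ∈ (midPresHom m).range := by
    intro i
    have h := inr_mul_inl_single (Equiv.swap 0 i) 0
    rw [Equiv.swap_apply_left] at h
    rw [← mul_inv_eq_iff_eq_mul.2 h]
    exact mul_mem (mul_mem (hinr _) ⟨_, midPresHom_of m none⟩) (inv_mem (hinr _))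
  have hinl : ∀ v, SemidirectProduct.inl v ∈ (midPresHom m).range := by
    intro v
    have hv : v = ∏ i, ofAdd (Pi.single i (1 : ℤ)) ^ (toAdd v i) := by
      refine Multiplicative.toAdd.injective (funext fun j => ?_)
      simp [toAdd_prod, Finset.sum_apply, Pi.single_apply]
    have hmem : v ∈ (midPresHom m).range.comap SemidirectProduct.inl := by
      rw [hv]
      exact Subgroup.prod_mem _ fun i _ => Subgroup.zpow_mem _ (Subgroup.mem_comap.2 (hbasis i)) _
    exact hmem
  intro x _
  rw [← SemidirectProduct.inl_left_mul_inr_right x]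
  exact mul_mem (hinl _) (hinr _)

/-- For `n = m + 2 ≥ 2`, the group presented by generators `t, s_1, …, s_{n−1}` with relations
`s_i² = 1`, commutation of distant `s_i`, braiding of adjacent `s_i`, `t s_i = s_i t` for
`i ≥ 2`, and `t s_1 t s_1 = s_1 t s_1 t` is isomorphic to the middle group `Mid(B_n)` via
`t ↦ (e_1, 1)` and `s_i ↦ (0, swap i (i+1))`. -/
theorem middle_group_presentation (m : ℕ) :
    ∃ φ : PresentedGroup (midPresRels m) ≃* Mid (m + 2),
      φ (PresentedGroup.of none) =
        SemidirectProduct.inl (ofAdd (Pi.single (0 : Fin (m + 2)) (1 : ℤ))) ∧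
      ∀ i : Fin (m + 1),
        φ (PresentedGroup.of (some i)) =
          SemidirectProduct.inr (Equiv.swap i.castSucc i.succ) := by
  exact ⟨MulEquiv.ofBijective (midPresHom m) ⟨midPresHom_injective m, midPresHom_surjective m⟩,
    midPresHom_of m none, fun i => midPresHom_of m (some i)⟩
end
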